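/- arXiv:1511.01241 — 8 statements merged into one kernel-verified Lean document; each statement's English description precedes it below -/
import Mathlib

section
/- Let k, l be natural numbers, n = k + l, let p be a complex-valued Schwartz function on ℝ^n × ℝ^n (variables written (t,u;τ,μ) with t,τ ∈ ℝ^k and u,μ ∈ ℝ^l), and let a be a complex-valued Schwartz function on ℝ^k × ℝ^l with Fourier transform â(σ,ν) = ∫ e^{−i(t·σ + u·ν)} a(t,u) dt du. Then for every ħ > 0 and every (t,u) ∈ ℝ^k × ℝ^l, the absolutely convergent iterated integral (2πħ)^{−n} ∫_{(τ,μ)∈ℝ^n} ( ∫_{(t̃,ũ)∈ℝ^n} e^{(i/ħ)((t−t̃)·τ + (u−ũ)·μ)} p(t,u,τ,μ) a(t̃, ũ/√ħ) dt̃ dũ ) dτ dμ equals b_ħ(t, u/√ħ), where b_ħ(t,v) := (2π)^{−n} ∫_{ℝ^n} e^{i(t·τ + v·μ)} p(t, √ħ v, ħτ, √ħ μ) â(τ,μ) dτ dμ. -/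
open MeasureTheory

/-- Change of variables for the anisotropic dilation `(x, y) ↦ (c • x, d • y)`. -/
theorem integral_eq_smul_integral_comp_prod_smul {k l : ℕ} {c d : ℝ} (hc : 0 < c) (hd : 0 < d)
    (f : (Fin k → ℝ) × (Fin l → ℝ) → ℂ) :
    ∫ x, f x = ((c ^ k * d ^ l : ℝ) : ℂ) *
      ∫ x : (Fin k → ℝ) × (Fin l → ℝ), f (c • x.1, d • x.2) := by
  have hmap : Measure.map (Prod.map (c • ·) (d • ·))
      (volume : Measure ((Fin k → ℝ) × (Fin l → ℝ))) =
      (ENNReal.ofReal (c ^ k)⁻¹ * ENNReal.ofReal (d ^ l)⁻¹) • volume := by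
    rw [Measure.volume_eq_prod, ← Measure.map_prod_map _ _ (measurable_const_smul c)
      (measurable_const_smul d), Measure.map_addHaar_smul _ hc.ne',
      Measure.map_addHaar_smul _ hd.ne', Measure.prod_smul_left, Measure.prod_smul_right, smul_smul]
    simp [abs_of_pos hc, abs_of_pos hd]
  have hemb : MeasurableEmbedding
      (Prod.map (c • ·) (d • ·) : (Fin k → ℝ) × (Fin l → ℝ) → (Fin k → ℝ) × (Fin l → ℝ)) :=
    (measurableEmbedding_const_smul₀ hc.ne').prodMap (measurableEmbedding_const_smul₀ hd.ne')
  have h := hemb.integral_map (μ := volume) f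
  simp only [Prod.map] at h hmap
  have hck : (c : ℂ) ≠ 0 := by exact_mod_cast hc.ne'
  have hdl : (d : ℂ) ≠ 0 := by exact_mod_cast hd.ne'
  rw [← h, hmap, integral_smul_measure, ENNReal.toReal_mul, ENNReal.toReal_ofReal (by positivity),
    ENNReal.toReal_ofReal (by positivity), Complex.real_smul]
  push_cast
  field_simp

/-- The action of a semiclassical pseudodifferential operator with Schwartz symbol `p`
(left quantization) on the model isotropic state `Υ(t,u,hbar) = a(t, hbar^{-1/2} u)`:
the iterated oscillatory integral equals `b_hbar(t, u/√hbar)` where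
`b_hbar(t,v) = (2π)^{-n} ∫ e^{i(t·τ+v·μ)} p(t,√hbar v, hbar τ, √hbar μ) â(τ,μ) dτ dμ`. -/
theorem psido_on_model_state_scaling (k l : ℕ)
    (p : SchwartzMap (((Fin k → ℝ) × (Fin l → ℝ)) × ((Fin k → ℝ) × (Fin l → ℝ))) ℂ)
    (a : SchwartzMap ((Fin k → ℝ) × (Fin l → ℝ)) ℂ)
    (ahat : (Fin k → ℝ) × (Fin l → ℝ) → ℂ)
    (hahat : ∀ σν : (Fin k → ℝ) × (Fin l → ℝ),
      ahat σν = ∫ q : (Fin k → ℝ) × (Fin l → ℝ),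
        Complex.exp (-Complex.I *
          (((∑ i, q.1 i * σν.1 i) + ∑ j, q.2 j * σν.2 j : ℝ) : ℂ)) * a q)
    (hbar : ℝ) (hhb : 0 < hbar) (t : Fin k → ℝ) (u : Fin l → ℝ) :
    ((((2 * Real.pi * hbar) ^ (k + l) : ℝ)) : ℂ)⁻¹ *
      ∫ ξ : (Fin k → ℝ) × (Fin l → ℝ),
        ∫ y : (Fin k → ℝ) × (Fin l → ℝ),
          Complex.exp ((Complex.I / (hbar : ℂ)) *
            (((∑ i, (t i - y.1 i) * ξ.1 i) + ∑ j, (u j - y.2 j) * ξ.2 j : ℝ) : ℂ)) *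
            p ((t, u), ξ) * a (y.1, (Real.sqrt hbar)⁻¹ • y.2)
    = (fun v : Fin l → ℝ =>
        ((((2 * Real.pi) ^ (k + l) : ℝ)) : ℂ)⁻¹ *
          ∫ ξ : (Fin k → ℝ) × (Fin l → ℝ),
            Complex.exp (Complex.I *
              (((∑ i, t i * ξ.1 i) + ∑ j, v j * ξ.2 j : ℝ) : ℂ)) *
              p ((t, Real.sqrt hbar • v), (hbar • ξ.1, Real.sqrt hbar • ξ.2)) * ahat ξ)
      ((Real.sqrt hbar)⁻¹ • u) := by
  obtain ⟨s, hs, rfl⟩ : ∃ s : ℝ, 0 < s ∧ hbar = s ^ 2 :=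
    ⟨Real.sqrt hbar, Real.sqrt_pos.2 hhb, (Real.sq_sqrt hhb.le).symm⟩
  have hsC : (s : ℂ) ≠ 0 := by exact_mod_cast hs.ne'
  have hpi : (Real.pi : ℂ) ≠ 0 := by exact_mod_cast Real.pi_ne_zero
  simp only [Real.sqrt_sq hs.le]
  have inner_eq (ξ : (Fin k → ℝ) × (Fin l → ℝ)) :
      ∫ y : (Fin k → ℝ) × (Fin l → ℝ),
        Complex.exp ((Complex.I / ((s ^ 2 : ℝ) : ℂ)) *
          (((∑ i, (t i - y.1 i) * (s ^ 2 • ξ.1) i) +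
            ∑ j, (u j - y.2 j) * (s • ξ.2) j : ℝ) : ℂ)) *
          p ((t, u), (s ^ 2 • ξ.1, s • ξ.2)) * a (y.1, s⁻¹ • y.2) =
      (s : ℂ) ^ l * (Complex.exp (Complex.I *
        (((∑ i, t i * ξ.1 i) + ∑ j, (s⁻¹ • u) j * ξ.2 j : ℝ) : ℂ)) *
        p ((t, u), (s ^ 2 • ξ.1, s • ξ.2)) * ahat ξ) := by
    rw [integral_eq_smul_integral_comp_prod_smul one_pos hs, hahat]
    simp only [one_smul, one_pow, one_mul, smul_smul, inv_mul_cancel₀ hs.ne']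
    rw [Complex.ofReal_pow]
    congr 1
    rw [← integral_const_mul]
    refine integral_congr_ae (Filter.Eventually.of_forall fun y => ?_)
    have phase : (Complex.I / ((s ^ 2 : ℝ) : ℂ)) *
          (((∑ i, (t i - y.1 i) * (s ^ 2 • ξ.1) i) +
            ∑ j, (u j - (s • y.2) j) * (s • ξ.2) j : ℝ) : ℂ) =
        Complex.I * (((∑ i, t i * ξ.1 i) + ∑ j, (s⁻¹ • u) j * ξ.2 j : ℝ) : ℂ) +
        -Complex.I * (((∑ i, y.1 i * ξ.1 i) + ∑ j, y.2 j * ξ.2 j : ℝ) : ℂ) := by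
      have hreal : (∑ i, (t i - y.1 i) * (s ^ 2 • ξ.1) i) +
            ∑ j, (u j - (s • y.2) j) * (s • ξ.2) j =
          s ^ 2 * (((∑ i, t i * ξ.1 i) + ∑ j, (s⁻¹ • u) j * ξ.2 j) -
            ((∑ i, y.1 i * ξ.1 i) + ∑ j, y.2 j * ξ.2 j)) := by
        rw [add_sub_add_comm, ← Finset.sum_sub_distrib, ← Finset.sum_sub_distrib, mul_add,
          Finset.mul_sum, Finset.mul_sum]
        congr 1 <;> refine Finset.sum_congr rfl fun i _ => ?_ <;>
          simp only [Pi.smul_apply, smul_eq_mul] <;> field_simp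
      rw [hreal, Complex.ofReal_mul, Complex.ofReal_sub, Complex.ofReal_pow]
      field_simp
      ring
    dsimp only
    rw [phase, Complex.exp_add]
    ring
  rw [integral_eq_smul_integral_comp_prod_smul (pow_pos hs 2) hs]
  simp only [inner_eq, integral_const_mul, smul_smul, mul_inv_cancel₀ hs.ne', one_smul]
  simp only [← mul_assoc]
  congr 1
  push_cast
  field_simp
  ring
end

section
/- Let k, l be natural numbers, n = k + l, let p be a complex-valued Schwartz function on ℝ^n × ℝ^n (variables (t,u;τ,μ)), let a be a complex-valued Schwartz function on ℝ^k × ℝ^l with Fourier transform â(σ,ν) = ∫ e^{−i(t·σ + u·ν)} a(t,u) dt du, and for ħ > 0 set b_ħ(t,v) = (2π)^{−n} ∫_{ℝ^n} e^{i(t·τ + v·μ)} p(t, √ħ v, ħτ, √ħ μ) â(τ,μ) dτ dμ. Then for every (t,v) ∈ ℝ^k × ℝ^l, lim_{ħ→0⁺} b_ħ(t,v) = p(t,0,0,0)·a(t,v). -/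
open MeasureTheory Filter

open scoped FourierTransform SchwartzMap

/-- The linear identification of `ℝ^(k + l)`, with its Euclidean norm, with `ℝ^k × ℝ^l`. -/
noncomputable def euclideanSumEquivProd (k l : ℕ) :
    EuclideanSpace ℝ (Fin k ⊕ Fin l) ≃L[ℝ] (Fin k → ℝ) × (Fin l → ℝ) :=
  (EuclideanSpace.equiv (Fin k ⊕ Fin l) ℝ).trans
    (ContinuousLinearEquiv.sumPiEquivProdPi ℝ (Fin k) (Fin l) fun _ => ℝ)

lemma volume_preserving_euclideanSumEquivProd (k l : ℕ) :
    MeasurePreserving (euclideanSumEquivProd k l) :=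
  (volume_measurePreserving_sumPiEquivProdPi fun _ : Fin k ⊕ Fin l => ℝ).comp
    (PiLp.volume_preserving_ofLp (Fin k ⊕ Fin l))

lemma integral_comp_euclideanSumEquivProd (k l : ℕ) (g : (Fin k → ℝ) × (Fin l → ℝ) → ℂ) :
    ∫ y, g (euclideanSumEquivProd k l y) = ∫ q, g q :=
  (volume_preserving_euclideanSumEquivProd k l).integral_comp
    (euclideanSumEquivProd k l).toHomeomorph.measurableEmbedding g

lemma inner_eq_euclideanSumEquivProd (k l : ℕ) (x y : EuclideanSpace ℝ (Fin k ⊕ Fin l)) :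
    inner ℝ x y =
      (∑ i, (euclideanSumEquivProd k l x).1 i * (euclideanSumEquivProd k l y).1 i) +
        ∑ j, (euclideanSumEquivProd k l x).2 j * (euclideanSumEquivProd k l y).2 j := by
  simp only [PiLp.inner_apply, Fintype.sum_sum_type, RCLike.inner_apply, conj_trivial]
  congr 1 <;> exact Finset.sum_congr rfl fun _ _ => mul_comm _ _

/-- The Schwartz function on Euclidean space corresponding to one on `ℝ^k × ℝ^l`. -/
noncomputable def schwartzPullback {k l : ℕ} (a : 𝓢((Fin k → ℝ) × (Fin l → ℝ), ℂ)) :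
    𝓢(EuclideanSpace ℝ (Fin k ⊕ Fin l), ℂ) :=
  SchwartzMap.compCLMOfContinuousLinearEquiv ℂ (euclideanSumEquivProd k l) a

lemma schwartzPullback_apply {k l : ℕ} (a : 𝓢((Fin k → ℝ) × (Fin l → ℝ), ℂ))
    (x : EuclideanSpace ℝ (Fin k ⊕ Fin l)) :
    schwartzPullback a x = a (euclideanSumEquivProd k l x) := rfl

/-- The Fourier integral with kernel `exp (-i q·σ)` in terms of Mathlib's Fourier transform. -/
lemma integral_exp_neg_mul_eq_fourier {k l : ℕ} (a : 𝓢((Fin k → ℝ) × (Fin l → ℝ), ℂ))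
    (y : EuclideanSpace ℝ (Fin k ⊕ Fin l)) :
    ∫ q : (Fin k → ℝ) × (Fin l → ℝ),
      Complex.exp (-Complex.I *
        (((∑ i, q.1 i * (euclideanSumEquivProd k l y).1 i) +
          ∑ j, q.2 j * (euclideanSumEquivProd k l y).2 j : ℝ) : ℂ)) * a q =
      𝓕 (schwartzPullback a) ((2 * Real.pi)⁻¹ • y) := by
  rw [SchwartzMap.fourier_coe, Real.fourier_eq', ← integral_comp_euclideanSumEquivProd]
  refine integral_congr_ae (.of_forall fun x => ?_)
  simp only [smul_eq_mul, schwartzPullback_apply, ← inner_eq_euclideanSumEquivProd,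
    real_inner_smul_right]
  congr 2
  have : (Real.pi : ℂ) ≠ 0 := by exact_mod_cast Real.pi_ne_zero
  push_cast
  field_simp

/-- Fourier inversion with the kernel `exp (i x·y)`. -/
lemma integral_exp_mul_fourier_smul {k l : ℕ} (A : 𝓢(EuclideanSpace ℝ (Fin k ⊕ Fin l), ℂ))
    (x : EuclideanSpace ℝ (Fin k ⊕ Fin l)) :
    ∫ y, Complex.exp (Complex.I * ((inner ℝ x y : ℝ) : ℂ)) * 𝓕 A ((2 * Real.pi)⁻¹ • y) =
      (((2 * Real.pi) ^ (k + l) : ℝ) : ℂ) * A x := by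
  have hinv : 𝓕⁻ (𝓕 A) x = A x := by rw [FourierTransform.fourierInv_fourier_eq]
  rw [SchwartzMap.fourierInv_coe, Real.fourierInv_eq'] at hinv
  have hpi : (0 : ℝ) ≤ (2 * Real.pi)⁻¹ := by positivity
  have hscale := Measure.integral_comp_smul_of_nonneg volume
    (fun η => Complex.exp (((2 * Real.pi * inner ℝ η x : ℝ) : ℂ) * Complex.I) • 𝓕 A η)
    (2 * Real.pi)⁻¹ (hR := hpi)
  rw [hinv] at hscale
  simp only [finrank_euclideanSpace, Fintype.card_sum, Fintype.card_fin, inv_pow, inv_inv,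
    Complex.real_smul] at hscale
  rw [← hscale]
  refine integral_congr_ae (.of_forall fun y => ?_)
  simp only [smul_eq_mul, real_inner_comm x, real_inner_smul_right]
  congr 2
  have : (Real.pi : ℂ) ≠ 0 := by exact_mod_cast Real.pi_ne_zero
  push_cast
  field_simp

/-- The leading symbol of the action of a pseudodifferential operator on a model
isotropic state: `lim_{hbar→0⁺} b_hbar(t,v) = p(t,0,0,0)·a(t,v)`, where
`b_hbar(t,v) = (2π)^{-n} ∫ e^{i(t·τ+v·μ)} p(t,√hbar v, hbar τ, √hbar μ) â(τ,μ) dτ dμ`. -/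
theorem psido_on_model_state_symbol (k l : ℕ)
    (p : SchwartzMap (((Fin k → ℝ) × (Fin l → ℝ)) × ((Fin k → ℝ) × (Fin l → ℝ))) ℂ)
    (a : SchwartzMap ((Fin k → ℝ) × (Fin l → ℝ)) ℂ)
    (ahat : (Fin k → ℝ) × (Fin l → ℝ) → ℂ)
    (hahat : ∀ σν : (Fin k → ℝ) × (Fin l → ℝ),
      ahat σν = ∫ q : (Fin k → ℝ) × (Fin l → ℝ),
        Complex.exp (-Complex.I *
          (((∑ i, q.1 i * σν.1 i) + ∑ j, q.2 j * σν.2 j : ℝ) : ℂ)) * a q)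
    (t : Fin k → ℝ) (v : Fin l → ℝ) :
    Tendsto (fun hbar : ℝ =>
        ((((2 * Real.pi) ^ (k + l) : ℝ)) : ℂ)⁻¹ *
          ∫ ξ : (Fin k → ℝ) × (Fin l → ℝ),
            Complex.exp (Complex.I *
              (((∑ i, t i * ξ.1 i) + ∑ j, v j * ξ.2 j : ℝ) : ℂ)) *
              p ((t, Real.sqrt hbar • v), (hbar • ξ.1, Real.sqrt hbar • ξ.2)) * ahat ξ)
      (nhdsWithin 0 (Set.Ioi 0))
      (nhds (p ((t, 0), (0, 0)) * a (t, v))) := by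
  set e := euclideanSumEquivProd k l with he
  set A := schwartzPullback a with hA
  have hahat_fourier (y : EuclideanSpace ℝ (Fin k ⊕ Fin l)) :
      ahat (e y) = 𝓕 A ((2 * Real.pi)⁻¹ • y) := by
    rw [hahat, integral_exp_neg_mul_eq_fourier]
  have hahat_int : Integrable ahat := by
    rw [← (volume_preserving_euclideanSumEquivProd k l).integrable_comp_emb
      (euclideanSumEquivProd k l).toHomeomorph.measurableEmbedding]
    have h : Integrable fun y => 𝓕 A ((2 * Real.pi)⁻¹ • y) :=
      (𝓕 A).integrable.comp_smul (by positivity)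
    exact h.congr (.of_forall fun y => (hahat_fourier y).symm)
  have hlim : ((((2 * Real.pi) ^ (k + l) : ℝ)) : ℂ)⁻¹ *
      ∫ ξ : (Fin k → ℝ) × (Fin l → ℝ),
        Complex.exp (Complex.I * (((∑ i, t i * ξ.1 i) + ∑ j, v j * ξ.2 j : ℝ) : ℂ)) *
          p ((t, 0), (0, 0)) * ahat ξ = p ((t, 0), (0, 0)) * a (t, v) := by
    have hinv := integral_exp_mul_fourier_smul A (e.symm (t, v))
    simp_rw [← hahat_fourier, inner_eq_euclideanSumEquivProd, ← he, e.apply_symm_apply] at hinv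
    rw [integral_comp_euclideanSumEquivProd k l (fun ξ => Complex.exp (Complex.I *
      (((∑ i, t i * ξ.1 i) + ∑ j, v j * ξ.2 j : ℝ) : ℂ)) * ahat ξ), hA, schwartzPullback_apply,
      ← he, e.apply_symm_apply] at hinv
    simp_rw [mul_right_comm _ (p ((t, 0), (0, 0)))]
    rw [integral_mul_const, hinv]
    have : (((2 * Real.pi) ^ (k + l) : ℝ) : ℂ) ≠ 0 := by
      exact_mod_cast (by positivity : (2 * Real.pi) ^ (k + l) ≠ 0)
    field_simp
  rw [← hlim]
  refine Tendsto.const_mul _ ?_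
  refine tendsto_integral_filter_of_dominated_convergence
    (fun ξ => SchwartzMap.seminorm ℝ 0 0 p * ‖ahat ξ‖) ?_ ?_ (hahat_int.norm.const_mul _) ?_
  · refine .of_forall fun hbar => AEStronglyMeasurable.mul ?_ hahat_int.aestronglyMeasurable
    refine Continuous.aestronglyMeasurable (.mul (by fun_prop) (p.continuous.comp (by fun_prop)))
  · refine .of_forall fun hbar => .of_forall fun ξ => ?_
    rw [norm_mul, norm_mul, mul_comm Complex.I, Complex.norm_exp_ofReal_mul_I, one_mul]
    gcongr
    exact p.norm_le_seminorm ℝ _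
  · refine .of_forall fun ξ => Tendsto.mul_const _ (Tendsto.const_mul _ ?_)
    have hcont : Continuous fun hbar : ℝ =>
        p ((t, Real.sqrt hbar • v), (hbar • ξ.1, Real.sqrt hbar • ξ.2)) :=
      p.continuous.comp (by fun_prop)
    simpa using (hcont.tendsto 0).mono_left nhdsWithin_le_nhds
end

section
/- Let k, l be natural numbers, n = k + l, let p be a complex-valued Schwartz function on ℝ^n × ℝ^n (variables (t,u;τ,μ)) satisfying p(t,0,0,0) = 0 for all t ∈ ℝ^k, let a be a complex-valued Schwartz function on ℝ^k × ℝ^l with Fourier transform â(σ,ν) = ∫ e^{−i(t·σ + u·ν)} a(t,u) dt du, and for ħ > 0 set b_ħ(t,v) = (2π)^{−n} ∫_{ℝ^n} e^{i(t·τ + v·μ)} p(t, √ħ v, ħτ, √ħ μ) â(τ,μ) dτ dμ. Then for every (t,v) ∈ ℝ^k × ℝ^l, lim_{ħ→0⁺} ħ^{−1/2} b_ħ(t,v) = (Σ_{j=1}^l v_j ∂p/∂u_j(t,0,0,0)) a(t,v) + (1/i) Σ_{j=1}^l ∂p/∂μ_j(t,0,0,0) ∂a/∂v_j(t,v). -/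
open MeasureTheory Filter
open scoped FourierTransform LineDeriv SchwartzMap

/-- The continuous linear equivalence forgetting the Euclidean structure. -/
noncomputable def euclideanProdEquiv (k l : ℕ) :
    WithLp 2 (EuclideanSpace ℝ (Fin k) × EuclideanSpace ℝ (Fin l)) ≃L[ℝ]
      (Fin k → ℝ) × (Fin l → ℝ) :=
  (WithLp.prodContinuousLinearEquiv 2 ℝ _ _).trans
    ((EuclideanSpace.equiv (Fin k) ℝ).prodCongr (EuclideanSpace.equiv (Fin l) ℝ))

theorem measurePreserving_euclideanProdEquiv (k l : ℕ) :
    MeasurePreserving (euclideanProdEquiv k l) :=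
  ((PiLp.volume_preserving_ofLp (Fin k)).prod (PiLp.volume_preserving_ofLp (Fin l))).comp
    (WithLp.volume_preserving_ofLp _ _)

theorem inner_eq_euclideanProdEquiv (k l : ℕ)
    (x y : WithLp 2 (EuclideanSpace ℝ (Fin k) × EuclideanSpace ℝ (Fin l))) :
    inner ℝ x y = (∑ i, (euclideanProdEquiv k l x).1 i * (euclideanProdEquiv k l y).1 i) +
      ∑ j, (euclideanProdEquiv k l x).2 j * (euclideanProdEquiv k l y).2 j := by
  simp [WithLp.prod_inner_apply, PiLp.inner_apply, euclideanProdEquiv, mul_comm]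

theorem integral_exp_smul_fourier {E : Type*} [NormedAddCommGroup E] [InnerProductSpace ℝ E]
    [FiniteDimensional ℝ E] [MeasurableSpace E] [BorelSpace E] (A : 𝓢(E, ℂ)) (x : E) :
    ∫ w, Complex.exp (((2 * Real.pi * inner ℝ w x : ℝ) : ℂ) * Complex.I) * 𝓕 A w = A x := by
  rw [← congrArg (fun f : 𝓢(E, ℂ) => f x) (FourierTransform.fourierInv_fourier_eq (F := 𝓢(E, ℂ)) A),
    SchwartzMap.fourierInv_coe, Real.fourierInv_eq']
  rfl

theorem integral_exp_inner_mul_fourier {E : Type*} [NormedAddCommGroup E] [InnerProductSpace ℝ E]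
    [FiniteDimensional ℝ E] [MeasurableSpace E] [BorelSpace E] (A : 𝓢(E, ℂ)) (x m : E) :
    ∫ w, Complex.exp (((2 * Real.pi * inner ℝ w x : ℝ) : ℂ) * Complex.I) *
      (((2 * Real.pi * inner ℝ w m : ℝ) : ℂ) * 𝓕 A w) = Complex.I⁻¹ * fderiv ℝ A x m := by
  rw [← SchwartzMap.lineDerivOp_apply_eq_fderiv, ← integral_exp_smul_fourier, ← integral_const_mul]
  congr 1 with w
  rw [SchwartzMap.fourier_lineDerivOp_eq]
  have h : Function.HasTemperateGrowth fun w : E => inner ℝ w m := by fun_prop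
  simp [SchwartzMap.smulLeftCLM_apply_apply h]
  ring_nf
  simp

theorem tendsto_integral_mul_comp_schwartz {E W : Type*} [NormedAddCommGroup E]
    [NormedSpace ℝ E] [FiniteDimensional ℝ E] [MeasurableSpace E] [BorelSpace E]
    {μ : Measure E} [μ.IsAddHaarMeasure] [NormedAddCommGroup W] [NormedSpace ℝ W]
    (p : 𝓢(W, ℂ)) (G : 𝓢(E, ℂ)) (z z₁ : W) (hz : p z = 0) (L M : E →L[ℝ] W)
    (c : E → ℂ) (hc : Continuous c) (hc1 : ∀ w, ‖c w‖ ≤ 1) :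
    Tendsto (fun s : ℝ => (s : ℂ)⁻¹ *
        ∫ w, c w * p (z + s • (z₁ + L w) + s ^ 2 • M w) * G w ∂μ)
      (nhdsWithin 0 (Set.Ioi 0))
      (nhds (∫ w, c w * fderiv ℝ p z (z₁ + L w) * G w ∂μ)) := by
  obtain ⟨C, hC⟩ : ∃ C, ∀ x, ‖fderiv ℝ p x‖ ≤ C := by
    obtain ⟨C, hC⟩ := (SchwartzMap.fderivCLM ℝ W ℂ p).decay 0 0
    exact ⟨C, fun x => by simpa using! hC.2 x⟩
  have hC0 : 0 ≤ C := (norm_nonneg _).trans (hC z)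
  simp_rw [← integral_const_mul]
  apply tendsto_integral_filter_of_dominated_convergence
    (fun w => C * ‖z₁‖ * ‖G w‖ + C * (‖L‖ + ‖M‖) * (‖w‖ * ‖G w‖))
  · refine Eventually.of_forall fun s => Continuous.aestronglyMeasurable ?_
    have := p.continuous
    have := G.continuous
    fun_prop
  · have h1 : ∀ᶠ s : ℝ in nhdsWithin 0 (Set.Ioi 0), 0 < s ∧ s < 1 :=
      Ioo_mem_nhdsGT (by norm_num)
    filter_upwards [h1] with s hs
    refine Eventually.of_forall fun w => ?_
    have hp : ‖p (z + s • (z₁ + L w) + s ^ 2 • M w)‖ ≤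
        C * (s * (‖z₁‖ + ‖L‖ * ‖w‖ + ‖M‖ * ‖w‖)) := by
      have h := convex_univ.norm_image_sub_le_of_norm_fderiv_le (𝕜 := ℝ) (f := p) (C := C)
        (fun x _ => p.differentiableAt) (fun x _ => hC x) (Set.mem_univ z)
        (Set.mem_univ (z + s • (z₁ + L w) + s ^ 2 • M w))
      rw [hz, sub_zero] at h
      refine h.trans (mul_le_mul_of_nonneg_left ?_ hC0)
      have : z + s • (z₁ + L w) + s ^ 2 • M w - z = s • (z₁ + L w + s • M w) := by module
      rw [this, norm_smul, Real.norm_of_nonneg hs.1.le]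
      refine mul_le_mul_of_nonneg_left ?_ hs.1.le
      refine (norm_add₃_le).trans ?_
      gcongr
      · exact L.le_opNorm w
      · rw [norm_smul, Real.norm_of_nonneg hs.1.le]
        exact (mul_le_of_le_one_left (norm_nonneg _) hs.2.le).trans (M.le_opNorm w)
    calc ‖(s : ℂ)⁻¹ * (c w * p (z + s • (z₁ + L w) + s ^ 2 • M w) * G w)‖
        = s⁻¹ * (‖c w‖ * ‖p (z + s • (z₁ + L w) + s ^ 2 • M w)‖ * ‖G w‖) := by
          simp [abs_of_pos hs.1]
      _ ≤ s⁻¹ * (1 * (C * (s * (‖z₁‖ + ‖L‖ * ‖w‖ + ‖M‖ * ‖w‖))) * ‖G w‖) := by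
          have := inv_nonneg.2 hs.1.le
          gcongr
          exact hc1 w
      _ = _ := by
          have := hs.1.ne'
          field_simp
          ring
  · have h0 : Integrable (fun w => ‖G w‖) μ := G.integrable.norm
    have h1 : Integrable (fun w => ‖w‖ * ‖G w‖) μ := by simpa using G.integrable_pow_mul μ 1
    exact (h0.const_mul _).add (h1.const_mul _)
  · refine Eventually.of_forall fun w => ?_
    have hγ : HasDerivAt (fun s : ℝ => z + s • (z₁ + L w) + s ^ 2 • M w) (z₁ + L w) 0 := by
      have h1 := ((hasDerivAt_id (0 : ℝ)).smul_const (z₁ + L w)).const_add z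
      have h2 := ((hasDerivAt_id (0 : ℝ)).pow 2).smul_const (M w)
      simpa using! h1.add h2
    have hp : HasDerivAt (fun s : ℝ => p (z + s • (z₁ + L w) + s ^ 2 • M w))
        (fderiv ℝ p z (z₁ + L w)) 0 := by
      refine HasFDerivAt.comp_hasDerivAt (l := p) 0 ?_ hγ
      simpa using p.hasFDerivAt (x := z)
    have h := (hasDerivAt_iff_tendsto_slope_zero.1 hp).mono_left
      (nhdsWithin_mono 0 fun x (hx : 0 < x) => hx.ne')
    have h' := (h.const_mul (c w)).mul_const (G w)
    refine h'.congr fun s => ?_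
    simp [hz]
    ring

theorem integral_mul_fourier_eq (k l : ℕ)
    (a : 𝓢((Fin k → ℝ) × (Fin l → ℝ), ℂ)) (ahat : (Fin k → ℝ) × (Fin l → ℝ) → ℂ)
    (hahat : ∀ σν : (Fin k → ℝ) × (Fin l → ℝ),
      ahat σν = ∫ q : (Fin k → ℝ) × (Fin l → ℝ),
        Complex.exp (-Complex.I *
          (((∑ i, q.1 i * σν.1 i) + ∑ j, q.2 j * σν.2 j : ℝ) : ℂ)) * a q)
    (F : (Fin k → ℝ) × (Fin l → ℝ) → ℂ) :
    (((2 * Real.pi) ^ (k + l) : ℝ) : ℂ)⁻¹ * ∫ ξ, F ξ * ahat ξ =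
      ∫ w, F ((2 * Real.pi) • euclideanProdEquiv k l w) *
        𝓕 (SchwartzMap.compCLMOfContinuousLinearEquiv ℂ (euclideanProdEquiv k l) a) w := by
  have hemb : MeasurableEmbedding (euclideanProdEquiv k l) :=
    (euclideanProdEquiv k l).toHomeomorph.measurableEmbedding
  have key : ∀ w, 𝓕 (SchwartzMap.compCLMOfContinuousLinearEquiv ℂ (euclideanProdEquiv k l) a) w =
      ahat ((2 * Real.pi) • euclideanProdEquiv k l w) := by
    intro w
    rw [SchwartzMap.fourier_coe, Real.fourier_eq', hahat,
      ← (measurePreserving_euclideanProdEquiv k l).integral_comp hemb]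
    congr 1 with q
    rw [inner_eq_euclideanProdEquiv, smul_eq_mul]
    refine congrArg₂ (· * ·) (congrArg Complex.exp ?_) rfl
    simp only [Prod.smul_fst, Prod.smul_snd, Pi.smul_apply, smul_eq_mul,
      mul_left_comm _ (2 * Real.pi), ← Finset.mul_sum, ← mul_add]
    push_cast
    ring
  have hfin : Module.finrank ℝ (WithLp 2 (EuclideanSpace ℝ (Fin k) × EuclideanSpace ℝ (Fin l))) =
      k + l := by
    rw [(euclideanProdEquiv k l).toLinearEquiv.finrank_eq]
    simp
  simp_rw [key, ← map_smul]
  rw [← (measurePreserving_euclideanProdEquiv k l).integral_comp hemb,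
    Measure.integral_comp_smul volume
      (fun w => F (euclideanProdEquiv k l w) * ahat (euclideanProdEquiv k l w)), hfin,
    abs_of_pos (by positivity), Complex.real_smul, Complex.ofReal_inv]

/-- First transport equation: if the symbol `p` vanishes on the model isotropic
`Σ₀ = {(t,0;0,0)}`, then `lim_{hbar→0⁺} hbar^{-1/2} b_hbar(t,v)
= (Σ_j v_j ∂p/∂u_j(t,0,0,0)) a(t,v) + (1/i) Σ_j ∂p/∂μ_j(t,0,0,0) ∂a/∂v_j(t,v)`. -/
theorem first_transport_equation (k l : ℕ)
    (p : SchwartzMap (((Fin k → ℝ) × (Fin l → ℝ)) × ((Fin k → ℝ) × (Fin l → ℝ))) ℂ)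
    (hp0 : ∀ t : Fin k → ℝ, p ((t, 0), (0, 0)) = 0)
    (a : SchwartzMap ((Fin k → ℝ) × (Fin l → ℝ)) ℂ)
    (ahat : (Fin k → ℝ) × (Fin l → ℝ) → ℂ)
    (hahat : ∀ σν : (Fin k → ℝ) × (Fin l → ℝ),
      ahat σν = ∫ q : (Fin k → ℝ) × (Fin l → ℝ),
        Complex.exp (-Complex.I *
          (((∑ i, q.1 i * σν.1 i) + ∑ j, q.2 j * σν.2 j : ℝ) : ℂ)) * a q)
    (t : Fin k → ℝ) (v : Fin l → ℝ) :
    Tendsto (fun hbar : ℝ =>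
        ((Real.sqrt hbar : ℂ))⁻¹ *
          (((((2 * Real.pi) ^ (k + l) : ℝ)) : ℂ)⁻¹ *
            ∫ ξ : (Fin k → ℝ) × (Fin l → ℝ),
              Complex.exp (Complex.I *
                (((∑ i, t i * ξ.1 i) + ∑ j, v j * ξ.2 j : ℝ) : ℂ)) *
                p ((t, Real.sqrt hbar • v), (hbar • ξ.1, Real.sqrt hbar • ξ.2)) * ahat ξ))
      (nhdsWithin 0 (Set.Ioi 0))
      (nhds
        ((∑ j : Fin l, (v j : ℂ) *
            fderiv ℝ (fun z => p z) ((t, 0), (0, 0)) ((0, Pi.single j 1), (0, 0))) *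
          a (t, v)
        + Complex.I⁻¹ *
          ∑ j : Fin l,
            fderiv ℝ (fun z => p z) ((t, 0), (0, 0)) ((0, 0), (0, Pi.single j 1)) *
              fderiv ℝ (fun z => a z) (t, v) (0, Pi.single j 1))) := by
  set A := SchwartzMap.compCLMOfContinuousLinearEquiv ℂ (euclideanProdEquiv k l) a
  set x := (euclideanProdEquiv k l).symm (t, v) with hx
  let D := fderiv ℝ (fun z => p z) ((t, 0), (0, 0))
  let c : WithLp 2 (EuclideanSpace ℝ (Fin k) × EuclideanSpace ℝ (Fin l)) → ℂ :=
    fun w => Complex.exp (((2 * Real.pi * inner ℝ w x : ℝ) : ℂ) * Complex.I)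
  have hex : euclideanProdEquiv k l x = (t, v) := by simp [hx]
  let e := (euclideanProdEquiv k l : WithLp 2 (EuclideanSpace ℝ (Fin k) × EuclideanSpace ℝ (Fin l))
    →L[ℝ] (Fin k → ℝ) × (Fin l → ℝ))
  let L := (ContinuousLinearMap.inr ℝ ((Fin k → ℝ) × (Fin l → ℝ)) ((Fin k → ℝ) × (Fin l → ℝ))) ∘L
    (ContinuousLinearMap.inr ℝ (Fin k → ℝ) (Fin l → ℝ)) ∘L
    ((2 * Real.pi) • (ContinuousLinearMap.snd ℝ (Fin k → ℝ) (Fin l → ℝ)) ∘L e)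
  let M := (ContinuousLinearMap.inr ℝ ((Fin k → ℝ) × (Fin l → ℝ)) ((Fin k → ℝ) × (Fin l → ℝ))) ∘L
    (ContinuousLinearMap.inl ℝ (Fin k → ℝ) (Fin l → ℝ)) ∘L
    ((2 * Real.pi) • (ContinuousLinearMap.fst ℝ (Fin k → ℝ) (Fin l → ℝ)) ∘L e)
  have hcb : ∀ w, ‖c w‖ ≤ 1 := fun w => (Complex.norm_exp_ofReal_mul_I _).le
  have hcc : Continuous c := by fun_prop
  have hlim := tendsto_integral_mul_comp_schwartz (μ := volume) p (𝓕 A) ((t, 0), (0, 0))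
    ((0, v), (0, 0)) (hp0 t) L M c hcc hcb
  have hsqrt : Tendsto Real.sqrt (nhdsWithin 0 (Set.Ioi 0)) (nhdsWithin 0 (Set.Ioi 0)) := by
    refine tendsto_nhdsWithin_iff.2 ⟨?_, ?_⟩
    · simpa using (Real.continuous_sqrt.tendsto 0).mono_left nhdsWithin_le_nhds
    · filter_upwards [self_mem_nhdsWithin] with s hs using Real.sqrt_pos.2 hs
  have hsum : ∀ w : Fin l → ℝ, w = ∑ j, w j • Pi.single j (1 : ℝ) := fun w => by
    simpa using! (pi_eq_sum_univ' w)
  have hDv : D ((0, v), (0, 0)) = ∑ j, (v j : ℂ) * D ((0, Pi.single j 1), (0, 0)) := by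
    have : ∀ w : Fin l → ℝ, D ((0, w), (0, 0)) = (D ∘L
      (ContinuousLinearMap.inl ℝ ((Fin k → ℝ) × (Fin l → ℝ)) ((Fin k → ℝ) × (Fin l → ℝ))) ∘L
      (ContinuousLinearMap.inr ℝ (Fin k → ℝ) (Fin l → ℝ))) w := fun w => rfl
    simp only [this]
    conv_lhs => rw [hsum v]
    rw [map_sum]
    simp only [map_smul, Complex.real_smul]
  have hDL : ∀ w, D (L w) = ∑ j, D ((0, 0), (0, Pi.single j 1)) *
      ((2 * Real.pi * inner ℝ w ((euclideanProdEquiv k l).symm (0, Pi.single j 1)) : ℝ) : ℂ) := by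
    intro w
    have : ∀ w : Fin l → ℝ, D ((0, 0), (0, w)) = (D ∘L
      (ContinuousLinearMap.inr ℝ ((Fin k → ℝ) × (Fin l → ℝ)) ((Fin k → ℝ) × (Fin l → ℝ))) ∘L
      (ContinuousLinearMap.inr ℝ (Fin k → ℝ) (Fin l → ℝ))) w := fun w => rfl
    have hL : D (L w) = D ((0, 0), (0, (2 * Real.pi) • (euclideanProdEquiv k l w).2)) := rfl
    rw [hL]
    simp only [this]
    conv_lhs => rw [hsum (euclideanProdEquiv k l w).2]
    simp only [map_sum, map_smul, Complex.real_smul, Finset.mul_sum, inner_eq_euclideanProdEquiv]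
    refine Finset.sum_congr rfl fun j _ => ?_
    simp [Pi.single_apply]
    ring
  have hfd : ∀ j, fderiv ℝ A x ((euclideanProdEquiv k l).symm (0, Pi.single j 1)) =
      fderiv ℝ (fun z => a z) (t, v) (0, Pi.single j 1) := by
    intro j
    have : (A : _ → ℂ) = (a : _ → ℂ) ∘ euclideanProdEquiv k l := rfl
    rw [this, ContinuousLinearEquiv.comp_right_fderiv, hex]
    simp
  have hint0 : Integrable (fun w => c w * 𝓕 A w) :=
    (𝓕 A).integrable.bdd_mul hcc.aestronglyMeasurable (Eventually.of_forall hcb)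
  have hint1 : ∀ m, Integrable
      (fun w => c w * (((2 * Real.pi * inner ℝ w m : ℝ) : ℂ) * 𝓕 A w)) := by
    intro m
    have h : Function.HasTemperateGrowth
      fun w : WithLp 2 (EuclideanSpace ℝ (Fin k) × EuclideanSpace ℝ (Fin l)) =>
        2 * Real.pi * inner ℝ w m := by fun_prop
    refine Integrable.bdd_mul ?_ hcc.aestronglyMeasurable (Eventually.of_forall hcb)
    refine (SchwartzMap.smulLeftCLM ℂ (fun w => 2 * Real.pi * inner ℝ w m) (𝓕 A)).integrable.congr
      (Eventually.of_forall fun w => ?_)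
    rw [SchwartzMap.smulLeftCLM_apply_apply h, Complex.real_smul]
  have hval : ∫ w, c w * D (((0, v), (0, 0)) + L w) * 𝓕 A w =
      (∑ j : Fin l, (v j : ℂ) * D ((0, Pi.single j 1), (0, 0))) * a (t, v)
        + Complex.I⁻¹ * ∑ j : Fin l, D ((0, 0), (0, Pi.single j 1)) *
              fderiv ℝ (fun z => a z) (t, v) (0, Pi.single j 1) := by
    have hpt : ∀ w, c w * D (((0, v), (0, 0)) + L w) * 𝓕 A w =
        D ((0, v), (0, 0)) * (c w * 𝓕 A w) + ∑ j, D ((0, 0), (0, Pi.single j 1)) *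
          (c w * (((2 * Real.pi * inner ℝ w
            ((euclideanProdEquiv k l).symm (0, Pi.single j 1)) : ℝ) : ℂ) * 𝓕 A w)) := by
      intro w
      rw [map_add, hDL, mul_add, add_mul, Finset.mul_sum, Finset.sum_mul]
      congr 1
      · ring
      · exact Finset.sum_congr rfl fun j _ => by ring
    simp_rw [hpt]
    rw [integral_add (hint0.const_mul _) (integrable_finsetSum _ fun j _ => (hint1 _).const_mul _),
      integral_finsetSum _ fun j _ => (hint1 _).const_mul _]
    simp_rw [integral_const_mul]
    rw [integral_exp_smul_fourier, hDv]
    refine congrArg₂ (· + ·) (congrArg (_ * a ·) hex) ?_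
    rw [Finset.mul_sum]
    refine Finset.sum_congr rfl fun j _ => ?_
    rw [integral_exp_inner_mul_fourier, hfd]
    ring
  refine hval ▸ (hlim.comp hsqrt).congr' ?_
  filter_upwards [self_mem_nhdsWithin] with hbar hpos
  rw [integral_mul_fourier_eq k l a ahat hahat]
  simp only [Function.comp_apply]
  congr 2 with w
  congr 2
  · simp only [c, inner_eq_euclideanProdEquiv, hex, mul_comm Complex.I]
    simp only [Prod.smul_fst, Prod.smul_snd, Pi.smul_apply, smul_eq_mul,
      mul_left_comm _ (2 * Real.pi), ← Finset.mul_sum, ← mul_add]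
    simp only [mul_comm (t _), mul_comm (v _)]
  · congr 1
    rw [Real.sq_sqrt (le_of_lt hpos)]
    simp [L, M, e]
end

section
/- Let k, l be natural numbers, n = k + l, let a be a complex-valued Schwartz function on ℝ^k × ℝ^l, and let χ : ℝ^k × ℝ^l → ℂ be infinitely differentiable with compact support. Then: (i) if the support of χ is disjoint from ℝ^k × {0}, then for every N ∈ ℕ there is C > 0 such that for all ħ ∈ (0,1], sup_{(t,u)} |χ(t,u) a(t, u/√ħ)| ≤ C ħ^N; and (ii) if (τ₀,μ₀) ∈ ℝ^k × ℝ^l with (τ₀,μ₀) ≠ (0,0), then for every N ∈ ℕ there is C > 0 such that for all ħ ∈ (0,1], |∫_{ℝ^k×ℝ^l} e^{−i(t·τ₀ + u·μ₀)/ħ} χ(t,u) a(t, u/√ħ) dt du| ≤ C ħ^N. -/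
open MeasureTheory
open scoped LineDeriv

section Oscillatory

variable {V W : Type*} [NormedAddCommGroup V] [NormedSpace ℝ V]
  [NormedAddCommGroup W] [NormedSpace ℝ W]

/-- The anisotropic dilation `(t, u) ↦ (t, s • u)`. -/
noncomputable def sndDilation (V W : Type*) [NormedAddCommGroup V] [NormedSpace ℝ V]
    [NormedAddCommGroup W] [NormedSpace ℝ W] (s : ℝ) : V × W →L[ℝ] V × W :=
  (ContinuousLinearMap.fst ℝ V W).prod (s • ContinuousLinearMap.snd ℝ V W)

@[simp]
lemma sndDilation_apply (s : ℝ) (p : V × W) : sndDilation V W s p = (p.1, s • p.2) := rfl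

lemma contDiff_mul_schwartz_sndDilation {χ : V × W → ℂ} (hχ : ContDiff ℝ (⊤ : ℕ∞) χ)
    (a : SchwartzMap (V × W) ℂ) (s : ℝ) :
    ContDiff ℝ (⊤ : ℕ∞) fun p ↦ χ p * a (sndDilation V W s p) :=
  hχ.mul ((a.smooth _).comp (sndDilation V W s).contDiff)

lemma fderiv_mul_schwartz_sndDilation {χ : V × W → ℂ} (hχ : ContDiff ℝ (⊤ : ℕ∞) χ)
    (a : SchwartzMap (V × W) ℂ) (s : ℝ) (v p : V × W) :
    fderiv ℝ (fun p ↦ χ p * a (sndDilation V W s p)) p v =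
      fderiv ℝ χ p v * a (sndDilation V W s p) +
      χ p * (∂_{(v.1, (0 : W))} a) (sndDilation V W s p) +
      s * (χ p * (∂_{((0 : V), v.2)} a) (sndDilation V W s p)) := by
  have h₁ : HasFDerivAt χ (fderiv ℝ χ p) p :=
    (hχ.differentiable (by simp) p).hasFDerivAt
  have h₂ : HasFDerivAt (fun p ↦ a (sndDilation V W s p))
      ((fderiv ℝ a (sndDilation V W s p)).comp (sndDilation V W s)) p :=
    (a.differentiableAt.hasFDerivAt).comp p (sndDilation V W s).hasFDerivAt
  have hv : sndDilation V W s v = (v.1, (0 : W)) + s • ((0 : V), v.2) := by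
    ext <;> simp
  have h₃ : fderiv ℝ (fun p ↦ χ p * a (sndDilation V W s p)) p = _ := (h₁.mul h₂).fderiv
  rw [h₃]
  simp only [SchwartzMap.lineDerivOp_apply_eq_fderiv, add_apply,
    smul_apply, ContinuousLinearMap.comp_apply, hv, map_add, map_smul,
    smul_eq_mul, Complex.real_smul]
  ring

variable [FiniteDimensional ℝ V] [FiniteDimensional ℝ W]
  [MeasurableSpace V] [BorelSpace V] [MeasurableSpace W] [BorelSpace W]
  (μ : Measure (V × W)) [μ.IsAddHaarMeasure]

/-- Integration by parts against the phase `exp (c L)` in a direction `v` with `L v = 1`. -/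
lemma mul_integral_cexp_mul_eq_neg_integral_fderiv {E : Type*} [NormedAddCommGroup E]
    [NormedSpace ℝ E] [FiniteDimensional ℝ E] [MeasurableSpace E] [BorelSpace E]
    (μ : Measure E) [μ.IsAddHaarMeasure] (L : E →L[ℝ] ℝ) {v : E} (hv : L v = 1) (c : ℂ)
    {g : E → ℂ} (hg : ContDiff ℝ 1 g) (hgc : HasCompactSupport g) :
    c * ∫ p, Complex.exp (c * L p) * g p ∂μ =
      -∫ p, Complex.exp (c * L p) * fderiv ℝ g p v ∂μ := by
  have he : ∀ p, HasFDerivAt (fun p ↦ Complex.exp (c * L p))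
      (Complex.exp (c * L p) • c • (Complex.ofRealCLM.comp L)) p := fun p ↦
    (((Complex.ofRealCLM.comp L).hasFDerivAt (x := p)).const_mul c).cexp
  have hec : Continuous fun p ↦ Complex.exp (c * L p) := by fun_prop
  have hfe : ∀ p, fderiv ℝ (fun p ↦ Complex.exp (c * L p)) p v = c * Complex.exp (c * L p) := by
    intro p
    rw [(he p).fderiv]
    simp [hv, mul_comm]
  have hg'c : Continuous fun p ↦ fderiv ℝ g p v :=
    (hg.continuous_fderiv one_ne_zero).clm_apply continuous_const
  have hg's : HasCompactSupport fun p ↦ fderiv ℝ g p v := hgc.fderiv_apply (𝕜 := ℝ) v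
  have key := integral_mul_fderiv_eq_neg_fderiv_mul_of_integrable (μ := μ) (v := v)
    (f := fun p ↦ Complex.exp (c * L p)) (g := g)
    (by
      simp only [hfe]
      exact ((continuous_const.mul hec).mul hg.continuous).integrable_of_hasCompactSupport
        hgc.mul_left)
    ((hec.mul hg'c).integrable_of_hasCompactSupport hg's.mul_left)
    ((hec.mul hg.continuous).integrable_of_hasCompactSupport hgc.mul_left)
    (fun p _ ↦ (he p).differentiableAt)
    (fun p _ ↦ hg.differentiable one_ne_zero p)
  rw [key, neg_neg, ← integral_const_mul]
  simp only [hfe, mul_assoc]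

/-- Rapid decay of oscillatory integrals whose amplitude is concentrated at scale `s⁻¹` while the
phase oscillates at scale `s⁻²`. -/
lemma exists_norm_oscillatory_integral_le (L : V × W →L[ℝ] ℝ) {v : V × W} (hv : L v = 1)
    (M : ℕ) {χ : V × W → ℂ} (hχ : ContDiff ℝ (⊤ : ℕ∞) χ) (hχc : HasCompactSupport χ)
    (a : SchwartzMap (V × W) ℂ) :
    ∃ C > 0, ∀ s : ℝ, 1 ≤ s →
      ‖∫ p, Complex.exp (-Complex.I * s ^ 2 * L p) *
        (χ p * a (sndDilation V W s p)) ∂μ‖ ≤ C * s⁻¹ ^ M := by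
  have hnorm : ∀ (s : ℝ) (p : V × W), ‖Complex.exp (-Complex.I * s ^ 2 * L p)‖ = 1 := by
    intro s p
    have : -Complex.I * s ^ 2 * L p = ((-(s ^ 2 * L p) : ℝ) : ℂ) * Complex.I := by
      push_cast; ring
    rw [this, Complex.norm_exp_ofReal_mul_I]
  induction M generalizing χ a with
  | zero =>
    obtain ⟨D, hD, ha⟩ := a.decay 0 0
    have hint : Integrable (fun p ↦ ‖χ p‖ * D) μ :=
      ((hχ.continuous.integrable_of_hasCompactSupport hχc).norm).mul_const D
    refine ⟨(∫ p, ‖χ p‖ * D ∂μ) + 1, by positivity, fun s _ ↦ ?_⟩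
    rw [pow_zero, mul_one]
    refine (norm_integral_le_of_norm_le hint (.of_forall fun p ↦ ?_)).trans (by linarith)
    rw [norm_mul, hnorm, one_mul, norm_mul]
    gcongr
    simpa using ha (sndDilation V W s p)
  | succ M ih =>
    have hχ' : ContDiff ℝ (⊤ : ℕ∞) fun p ↦ fderiv ℝ χ p v :=
      (hχ.fderiv_right (by simp)).clm_apply contDiff_const
    have hχ'c : HasCompactSupport fun p ↦ fderiv ℝ χ p v := hχc.fderiv_apply (𝕜 := ℝ) v
    obtain ⟨C₁, hC₁, h₁⟩ := ih hχ' hχ'c a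
    obtain ⟨C₂, hC₂, h₂⟩ := ih hχ hχc (∂_{(v.1, (0 : W))} a)
    obtain ⟨C₃, hC₃, h₃⟩ := ih hχ hχc (∂_{((0 : V), v.2)} a)
    refine ⟨C₁ + C₂ + C₃, by positivity, fun s hs ↦ ?_⟩
    have hs0 : 0 < s := by linarith
    have hint : ∀ {ψ : V × W → ℂ}, ContDiff ℝ (⊤ : ℕ∞) ψ → HasCompactSupport ψ →
        ∀ b : SchwartzMap (V × W) ℂ, Integrable (fun p ↦
          Complex.exp (-Complex.I * s ^ 2 * L p) * (ψ p * b (sndDilation V W s p))) μ := by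
      intro ψ hψ hψc b
      refine Continuous.integrable_of_hasCompactSupport ?_ hψc.mul_right.mul_left
      have := (contDiff_mul_schwartz_sndDilation hψ b s).continuous
      fun_prop
    have key := mul_integral_cexp_mul_eq_neg_integral_fderiv μ L hv (-Complex.I * s ^ 2)
      ((contDiff_mul_schwartz_sndDilation hχ a s).of_le (by simp)) hχc.mul_right
    have hsplit : ∀ p, Complex.exp (-Complex.I * s ^ 2 * L p) *
        fderiv ℝ (fun p ↦ χ p * a (sndDilation V W s p)) p v =
        Complex.exp (-Complex.I * s ^ 2 * L p) *
          (fderiv ℝ χ p v * a (sndDilation V W s p)) +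
        Complex.exp (-Complex.I * s ^ 2 * L p) *
          (χ p * (∂_{(v.1, (0 : W))} a) (sndDilation V W s p)) +
        s * (Complex.exp (-Complex.I * s ^ 2 * L p) *
          (χ p * (∂_{((0 : V), v.2)} a) (sndDilation V W s p))) := by
      intro p
      rw [fderiv_mul_schwartz_sndDilation hχ]
      ring
    simp only [hsplit] at key
    have hint₁₂ : Integrable (fun p ↦
        Complex.exp (-Complex.I * s ^ 2 * L p) *
          (fderiv ℝ χ p v * a (sndDilation V W s p)) +
        Complex.exp (-Complex.I * s ^ 2 * L p) *
          (χ p * (∂_{(v.1, (0 : W))} a) (sndDilation V W s p))) μ :=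
      (hint hχ' hχ'c a).add (hint hχ hχc _)
    rw [integral_add hint₁₂ ((hint hχ hχc _).const_mul _),
      integral_add (hint hχ' hχ'c a) (hint hχ hχc _), integral_const_mul] at key
    have hle := congrArg norm key
    rw [norm_mul, norm_neg] at hle
    have hc : ‖-Complex.I * (s : ℂ) ^ 2‖ = s ^ 2 := by
      simp
    rw [hc] at hle
    have hbound : s ^ 2 * ‖∫ p, Complex.exp (-Complex.I * s ^ 2 * L p) *
        (χ p * a (sndDilation V W s p)) ∂μ‖ ≤
        C₁ * s⁻¹ ^ M + C₂ * s⁻¹ ^ M + s * (C₃ * s⁻¹ ^ M) := by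
      rw [hle]
      refine norm_add₃_le.trans ?_
      rw [norm_mul, Complex.norm_of_nonneg hs0.le]
      gcongr
      exacts [h₁ s hs, h₂ s hs, h₃ s hs]
    refine le_of_mul_le_mul_left (hbound.trans ?_) (pow_pos hs0 2)
    have : s ^ 2 * ((C₁ + C₂ + C₃) * s⁻¹ ^ (M + 1)) = s * ((C₁ + C₂ + C₃) * s⁻¹ ^ M) := by
      have h1 : s * s⁻¹ = 1 := mul_inv_cancel₀ hs0.ne'
      linear_combination s * (C₁ + C₂ + C₃) * s⁻¹ ^ M * h1
    rw [this]
    have hx : 0 ≤ (C₁ + C₂) * s⁻¹ ^ M := by positivity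
    nlinarith [mul_le_mul_of_nonneg_right hs hx]

end Oscillatory

/-- A state concentrated at scale `s⁻¹` on `u = 0` is rapidly decreasing in `s` on compact sets
away from `u = 0`. -/
lemma exists_norm_mul_schwartz_sndDilation_le {V W : Type*} [NormedAddCommGroup V]
    [NormedSpace ℝ V] [NormedAddCommGroup W] [NormedSpace ℝ W] {χ : V × W → ℂ}
    (hχ : Continuous χ) (hχc : HasCompactSupport χ) (hχ0 : ∀ p ∈ tsupport χ, p.2 ≠ 0)
    (a : SchwartzMap (V × W) ℂ) (M : ℕ) :
    ∃ C > 0, ∀ s : ℝ, 0 < s → ∀ p, ‖χ p * a (sndDilation V W s p)‖ ≤ C * s⁻¹ ^ M := by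
  obtain ⟨D, hD, ha⟩ := a.decay M 0
  have hcont : ContinuousOn (fun p : V × W ↦ ‖χ p‖ * ‖p.2‖⁻¹ ^ M) (tsupport χ) :=
    hχ.norm.continuousOn.mul ((continuous_snd.norm.continuousOn.inv₀
      fun p hp ↦ norm_ne_zero_iff.mpr (hχ0 p hp)).pow M)
  obtain ⟨B, hB⟩ := hχc.isCompact.exists_bound_of_continuousOn hcont
  refine ⟨(|B| + 1) * D, by positivity, fun s hs p ↦ ?_⟩
  by_cases hp : p ∈ tsupport χ
  · have hp2 : 0 < ‖p.2‖ := norm_pos_iff.mpr (hχ0 p hp)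
    have hle : s * ‖p.2‖ ≤ ‖sndDilation V W s p‖ := by
      refine le_trans (le_of_eq ?_) (norm_snd_le (sndDilation V W s p))
      simp [norm_smul, abs_of_pos hs]
    have h1 : ‖a (sndDilation V W s p)‖ ≤ D * (s * ‖p.2‖)⁻¹ ^ M := by
      rw [inv_pow, ← div_eq_mul_inv, le_div_iff₀ (by positivity), mul_comm]
      refine le_trans ?_ (ha (sndDilation V W s p))
      rw [norm_iteratedFDeriv_zero]
      gcongr
    have h2 : ‖χ p‖ * ‖p.2‖⁻¹ ^ M ≤ |B| + 1 :=
      ((le_abs_self _).trans (hB p hp)).trans ((le_abs_self B).trans (by linarith))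
    calc ‖χ p * a (sndDilation V W s p)‖ ≤ ‖χ p‖ * (D * (s * ‖p.2‖)⁻¹ ^ M) := by
          rw [norm_mul]; gcongr
      _ = ‖χ p‖ * ‖p.2‖⁻¹ ^ M * D * s⁻¹ ^ M := by rw [mul_inv, mul_pow]; ring
      _ ≤ (|B| + 1) * D * s⁻¹ ^ M := by gcongr
  · rw [image_eq_zero_of_notMem_tsupport hp, zero_mul, norm_zero]
    positivity

/-- The linear form `(t, u) ↦ t · τ + u · μ`. -/
noncomputable def prodDotCLM {k l : ℕ} (τ : Fin k → ℝ) (μ : Fin l → ℝ) :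
    (Fin k → ℝ) × (Fin l → ℝ) →L[ℝ] ℝ :=
  (∑ i, τ i • (ContinuousLinearMap.proj i).comp (ContinuousLinearMap.fst ℝ _ _)) +
    ∑ j, μ j • (ContinuousLinearMap.proj j).comp (ContinuousLinearMap.snd ℝ _ _)

lemma prodDotCLM_apply {k l : ℕ} (τ : Fin k → ℝ) (μ : Fin l → ℝ)
    (p : (Fin k → ℝ) × (Fin l → ℝ)) :
    prodDotCLM τ μ p = (∑ i, p.1 i * τ i) + ∑ j, p.2 j * μ j := by
  simp [prodDotCLM, mul_comm]

lemma exists_prodDotCLM_eq_one {k l : ℕ} {τ : Fin k → ℝ} {μ : Fin l → ℝ}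
    (h : (τ, μ) ≠ (0, 0)) : ∃ v, prodDotCLM τ μ v = 1 := by
  have hne : prodDotCLM τ μ (τ, μ) ≠ 0 := by
    intro h0
    rw [prodDotCLM_apply, add_eq_zero_iff_of_nonneg
      (Finset.sum_nonneg fun _ _ ↦ mul_self_nonneg _)
      (Finset.sum_nonneg fun _ _ ↦ mul_self_nonneg _)] at h0
    refine h (Prod.ext (funext fun i ↦ ?_) (funext fun j ↦ ?_))
    · exact mul_self_eq_zero.mp
        ((Finset.sum_eq_zero_iff_of_nonneg fun _ _ ↦ mul_self_nonneg _).mp h0.1 i (by simp))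
    · exact mul_self_eq_zero.mp
        ((Finset.sum_eq_zero_iff_of_nonneg fun _ _ ↦ mul_self_nonneg _).mp h0.2 j (by simp))
  exact ⟨(prodDotCLM τ μ (τ, μ))⁻¹ • (τ, μ), by rw [map_smul, smul_eq_mul, inv_mul_cancel₀ hne]⟩

/-- The semiclassical wave-front set of a model isotropic state
`Υ(t,u,hbar) = a(t, hbar^{-1/2}u)` is contained in `Σ₀ = {(t,0;ξ=0)}`:
(i) the state is `O(hbar^∞)` on any compact set away from `u = 0`;
(ii) the localized semiclassical Fourier transform is `O(hbar^∞)` at any nonzero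
frequency `(τ₀,μ₀)`. -/
theorem model_state_wavefront (k l : ℕ)
    (a : SchwartzMap ((Fin k → ℝ) × (Fin l → ℝ)) ℂ)
    (χ : (Fin k → ℝ) × (Fin l → ℝ) → ℂ)
    (hχs : ContDiff ℝ (⊤ : ℕ∞) χ) (hχc : HasCompactSupport χ) :
    ((∀ p ∈ tsupport χ, p.2 ≠ 0) →
      ∀ N : ℕ, ∃ C > 0, ∀ hbar ∈ Set.Ioc (0 : ℝ) 1,
        ∀ (t : Fin k → ℝ) (u : Fin l → ℝ),
          ‖χ (t, u) * a (t, (Real.sqrt hbar)⁻¹ • u)‖ ≤ C * hbar ^ N)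
    ∧ (∀ (τ₀ : Fin k → ℝ) (μ₀ : Fin l → ℝ), (τ₀, μ₀) ≠ (0, 0) →
        ∀ N : ℕ, ∃ C > 0, ∀ hbar ∈ Set.Ioc (0 : ℝ) 1,
          ‖∫ p : (Fin k → ℝ) × (Fin l → ℝ),
              Complex.exp (-Complex.I *
                ((((∑ i, p.1 i * τ₀ i) + ∑ j, p.2 j * μ₀ j : ℝ) : ℂ) / (hbar : ℂ))) *
                χ p * a (p.1, (Real.sqrt hbar)⁻¹ • p.2)‖ ≤ C * hbar ^ N) := by
  have hpow : ∀ {h : ℝ}, 0 < h → ∀ N : ℕ, ((Real.sqrt h)⁻¹)⁻¹ ^ (2 * N) = h ^ N := by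
    intro h hh N
    rw [inv_inv, pow_mul, Real.sq_sqrt hh.le]
  refine ⟨fun hχ0 N ↦ ?_, fun τ₀ μ₀ hne N ↦ ?_⟩
  · obtain ⟨C, hC, hle⟩ :=
      exists_norm_mul_schwartz_sndDilation_le hχs.continuous hχc hχ0 a (2 * N)
    refine ⟨C, hC, fun hbar hh t u ↦ ?_⟩
    rw [← hpow hh.1 N]
    exact hle _ (inv_pos.mpr (Real.sqrt_pos.mpr hh.1)) (t, u)
  · obtain ⟨v, hv⟩ := exists_prodDotCLM_eq_one hne
    have : (volume : Measure ((Fin k → ℝ) × (Fin l → ℝ))).IsAddHaarMeasure :=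
      Measure.prod.instIsAddHaarMeasure volume volume
    obtain ⟨C, hC, hle⟩ :=
      exists_norm_oscillatory_integral_le volume (prodDotCLM τ₀ μ₀) hv (2 * N) hχs hχc a
    refine ⟨C, hC, fun hbar hh ↦ ?_⟩
    rw [← hpow hh.1 N]
    refine le_of_eq_of_le (congrArg norm (integral_congr_ae (.of_forall fun p ↦ ?_)))
      (hle (Real.sqrt hbar)⁻¹
        ((one_le_inv₀ (Real.sqrt_pos.mpr hh.1)).mpr (Real.sqrt_le_one.mpr hh.2)))
    have hsq : (((Real.sqrt hbar)⁻¹ : ℝ) : ℂ) ^ 2 = (hbar : ℂ)⁻¹ := by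
      rw [← Complex.ofReal_pow, inv_pow, Real.sq_sqrt hh.1.le, Complex.ofReal_inv]
    simp only [hsq, prodDotCLM_apply, sndDilation_apply, div_eq_inv_mul, mul_assoc]
end

section
/- Let k, l be natural numbers. Let φ : ℝ^k × ℝ^l → ℝ be infinitely differentiable with φ(t,0) = 0 and ∂φ/∂u_r(t,0) = 0 for all t ∈ ℝ^k, r = 1,…,l, and assume φ has temperate growth in u locally uniformly in t: for all multi-indices α, β and every compact K ⊂ ℝ^k there exist C > 0 and M ∈ ℕ with |∂_t^α ∂_u^β φ(t,u)| ≤ C(1+‖u‖)^M for all (t,u) ∈ K × ℝ^l. Let a : ℝ^k × ℝ^l → ℂ be infinitely differentiable and Schwartz in the second variable locally uniformly in the first: for all multi-indices α, β, every N ∈ ℕ, and every compact K ⊂ ℝ^k there exists C with |∂_t^α ∂_v^β a(t,v)| ≤ C(1+‖v‖)^{−N} on K × ℝ^l. For ħ ∈ (0,1] define c_ħ(t,v) := exp(i φ(t, √ħ v)/ħ) a(t,v). Then: (i) for all (t,u) and ħ ∈ (0,1], e^{iφ(t,u)/ħ} a(t, u/√ħ) = c_ħ(t, u/√ħ); and (ii)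 the family {c_ħ} satisfies the same estimates uniformly in ħ: for all α, β, N, K there exists C such that for all ħ ∈ (0,1] and (t,v) ∈ K × ℝ^l, |∂_t^α ∂_v^β c_ħ(t,v)| ≤ C(1+‖v‖)^{−N}. -/
open Set
open scoped ContDiff

section PhaseRescaling

universe u

variable {X Y F : Type u} [NormedAddCommGroup X] [NormedSpace ℝ X]
  [NormedAddCommGroup Y] [NormedSpace ℝ Y] [NormedAddCommGroup F] [NormedSpace ℝ F]

/-- All derivatives of `f` grow at most polynomially in the second variable, locally uniformly in
the first. -/
def TemperateInSnd (f : X × Y → F) : Prop :=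
  ∀ (m : ℕ) (K : Set X), IsCompact K → ∃ C > 0, ∃ M : ℕ, ∀ t ∈ K, ∀ u : Y,
    ‖iteratedFDeriv ℝ m f (t, u)‖ ≤ C * (1 + ‖u‖) ^ M

/-- `f` vanishes to order `min j 2` along `{u = 0}`. -/
def VanishesOnZeroSection (j : ℕ) (f : X × Y → F) : Prop :=
  (1 ≤ j → ∀ t, f (t, 0) = 0) ∧ (2 ≤ j → ∀ t, fderiv ℝ f (t, 0) = 0)

/-- The derivative of `f` precomposed with `P`; for `P` a coordinate projection this is a partial
derivative. -/
noncomputable def fderivComp (P : X × Y →L[ℝ] X × Y) (f : X × Y → F) :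
    X × Y → X × Y →L[ℝ] F :=
  fun p => (fderiv ℝ f p).comp P

/-- The projection onto the first factor, as an endomorphism of the product. -/
noncomputable def projFst (X Y : Type u) [NormedAddCommGroup X] [NormedSpace ℝ X]
    [NormedAddCommGroup Y] [NormedSpace ℝ Y] : X × Y →L[ℝ] X × Y :=
  (ContinuousLinearMap.inl ℝ X Y).comp (ContinuousLinearMap.fst ℝ X Y)

/-- The projection onto the second factor, as an endomorphism of the product. -/
noncomputable def projSnd (X Y : Type u) [NormedAddCommGroup X] [NormedSpace ℝ X]
    [NormedAddCommGroup Y] [NormedSpace ℝ Y] : X × Y →L[ℝ] X × Y :=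
  (ContinuousLinearMap.inr ℝ X Y).comp (ContinuousLinearMap.snd ℝ X Y)

@[simp]
theorem projFst_apply (p : X × Y) : projFst X Y p = (p.1, 0) := by simp [projFst]

@[simp]
theorem projSnd_apply (p : X × Y) : projSnd X Y p = (0, p.2) := by simp [projSnd]

/-- The function `s⁻ʲ f(t, s u)`. -/
noncomputable def rescaleSnd (j : ℕ) (s : ℝ) (f : X × Y → F) : X × Y → F :=
  fun p => (s⁻¹) ^ j • f (p.1, s • p.2)

theorem contDiff_fderivComp (P : X × Y →L[ℝ] X × Y) {f : X × Y → F} (hf : ContDiff ℝ ∞ f) :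
    ContDiff ℝ ∞ (fderivComp P f) :=
  (hf.fderiv_right (m := ∞) (by simp)).clm_comp contDiff_const

theorem contDiff_rescaleSnd (j : ℕ) (s : ℝ) {f : X × Y → F} (hf : ContDiff ℝ ∞ f) :
    ContDiff ℝ ∞ (rescaleSnd j s f) :=
  (hf.comp (contDiff_fst.prodMk (contDiff_snd.const_smul s))).const_smul _

theorem TemperateInSnd.fderivComp (P : X × Y →L[ℝ] X × Y) {f : X × Y → F}
    (hf : ContDiff ℝ ∞ f) (h : TemperateInSnd f) : TemperateInSnd (fderivComp P f) := by
  intro m K hK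
  obtain ⟨C, hC, M, hb⟩ := h (m + 1) K hK
  set L := (ContinuousLinearMap.compL ℝ (X × Y) (X × Y) F).flip P
  refine ⟨(‖L‖ + 1) * C, by positivity, M, fun t ht u => ?_⟩
  have h1 := L.norm_iteratedFDeriv_comp_left (x := (t, u)) (n := m)
    (hf.fderiv_right (m := ∞) (by simp)).contDiffAt (by exact_mod_cast le_top)
  have h2 : L ∘ fderiv ℝ f = _root_.fderivComp P f := rfl
  rw [h2, norm_iteratedFDeriv_fderiv] at h1
  calc _ ≤ ‖L‖ * ‖iteratedFDeriv ℝ (m + 1) f (t, u)‖ := h1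
    _ ≤ (‖L‖ + 1) * (C * (1 + ‖u‖) ^ M) := by
      gcongr
      · linarith
      · exact hb t ht u
    _ = _ := by ring

theorem hasFDerivAt_comp_prodMk_left {f : X × Y → F} (hf : ContDiff ℝ ∞ f) (t : X) (u : Y) :
    HasFDerivAt (fun x => f (x, u)) ((fderiv ℝ f (t, u)).comp (ContinuousLinearMap.inl ℝ X Y)) t :=
  ((hf.differentiable (by simp)) (t, u)).hasFDerivAt.comp t (hasFDerivAt_prodMk_left t u)

theorem hasFDerivAt_comp_prodMk_right {f : X × Y → F} (hf : ContDiff ℝ ∞ f) (t : X) (u : Y) :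
    HasFDerivAt (fun y => f (t, y)) ((fderiv ℝ f (t, u)).comp (ContinuousLinearMap.inr ℝ X Y)) u :=
  ((hf.differentiable (by simp)) (t, u)).hasFDerivAt.comp u (hasFDerivAt_prodMk_right t u)

theorem fderiv_apply_fst_eq_zero {f : X × Y → F} (hf : ContDiff ℝ ∞ f)
    (h0 : ∀ t, f (t, 0) = 0) (t : X) (w : X) : fderiv ℝ f (t, 0) (w, 0) = 0 := by
  have h1 := hasFDerivAt_comp_prodMk_left hf t 0
  simp only [h0] at h1
  simpa using DFunLike.congr_fun (h1.unique (hasFDerivAt_const 0 t)) w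

theorem VanishesOnZeroSection.fderivComp_projFst {j : ℕ} {f : X × Y → F} (hf : ContDiff ℝ ∞ f)
    (h : VanishesOnZeroSection j f) :
    VanishesOnZeroSection j (fderivComp (projFst X Y) f) := by
  refine ⟨fun hj t => ?_, fun hj t => ?_⟩
  · refine ContinuousLinearMap.ext fun w => ?_
    simpa [fderivComp] using fderiv_apply_fst_eq_zero hf (h.1 hj) t w.1
  · have hf' : ContDiff ℝ ∞ (fderiv ℝ f) := hf.fderiv_right (by simp)
    set L := (ContinuousLinearMap.compL ℝ (X × Y) (X × Y) F).flip (projFst X Y)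
    have hL : fderivComp (projFst X Y) f = L ∘ fderiv ℝ f := rfl
    rw [hL, (L.hasFDerivAt.comp _ (hf'.differentiable (by simp) (t, 0)).hasFDerivAt).fderiv]
    refine ContinuousLinearMap.ext fun v => ContinuousLinearMap.ext fun w => ?_
    have hs : IsSymmSndFDerivAt ℝ f (t, 0) :=
      (contDiff_infty.1 hf 2).contDiffAt.isSymmSndFDerivAt (by simp)
    have h1 := fderiv_apply_fst_eq_zero hf' (h.2 hj) t w.1
    have h2 := hs v (w.1, 0)
    rw [h1] at h2
    simpa [L] using h2

theorem VanishesOnZeroSection.fderivComp_projSnd {j : ℕ} (hj : j ≤ 2) {f : X × Y → F}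
    (h : VanishesOnZeroSection j f) :
    VanishesOnZeroSection (j - 1) (fderivComp (projSnd X Y) f) := by
  refine ⟨fun h1 t => ?_, fun h2 => by omega⟩
  simp [fderivComp, h.2 (by omega) t]

/-- Quantitative vanishing gains one order from the derivative in the second variable. -/
theorem norm_le_of_norm_fderivComp_projSnd_le {f : X × Y → F} (hf : ContDiff ℝ ∞ f) {t : X}
    (h0 : f (t, 0) = 0) {C : ℝ} (hC : 0 ≤ C) {j M : ℕ}
    (hb : ∀ u, ‖fderivComp (projSnd X Y) f (t, u)‖ ≤ C * ‖u‖ ^ j * (1 + ‖u‖) ^ M) (u : Y) :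
    ‖f (t, u)‖ ≤ C * ‖u‖ ^ (j + 1) * (1 + ‖u‖) ^ M := by
  have key := (convex_closedBall (0 : Y) ‖u‖).norm_image_sub_le_of_norm_hasFDerivWithin_le
    (f := fun y => f (t, y)) (C := C * ‖u‖ ^ j * (1 + ‖u‖) ^ M) (x := 0) (y := u)
    (fun y _ => (hasFDerivAt_comp_prodMk_right hf t y).hasFDerivWithinAt)
    (fun y hy => ?_) (by simp) (by simp)
  · simp only [h0, sub_zero] at key
    calc _ ≤ _ := key
      _ = _ := by ring
  · have hy' : ‖y‖ ≤ ‖u‖ := by simpa using hy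
    have h1 : (fderiv ℝ f (t, y)).comp (ContinuousLinearMap.inr ℝ X Y)
        = (fderivComp (projSnd X Y) f (t, y)).comp (ContinuousLinearMap.inr ℝ X Y) := by
      ext w
      simp [fderivComp]
    rw [h1]
    calc _ ≤ ‖fderivComp (projSnd X Y) f (t, y)‖ * ‖ContinuousLinearMap.inr ℝ X Y‖ :=
          ContinuousLinearMap.opNorm_comp_le _ _
      _ ≤ ‖fderivComp (projSnd X Y) f (t, y)‖ * 1 := by
          gcongr
          exact ContinuousLinearMap.norm_inr_le_one ℝ X Y
      _ ≤ C * ‖y‖ ^ j * (1 + ‖y‖) ^ M := by simpa using hb y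
      _ ≤ _ := by gcongr

theorem VanishesOnZeroSection.exists_norm_le {j : ℕ} (hj : j ≤ 2) {f : X × Y → F}
    (hf : ContDiff ℝ ∞ f) (hT : TemperateInSnd f) (h : VanishesOnZeroSection j f)
    {K : Set X} (hK : IsCompact K) :
    ∃ C > 0, ∃ M : ℕ, ∀ t ∈ K, ∀ u : Y, ‖f (t, u)‖ ≤ C * ‖u‖ ^ j * (1 + ‖u‖) ^ M := by
  induction j generalizing F with
  | zero => simpa using hT 0 K hK
  | succ j ih =>
    obtain ⟨C, hC, M, hb⟩ := ih (by omega) (contDiff_fderivComp (projSnd X Y) hf)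
      (hT.fderivComp (projSnd X Y) hf) (h.fderivComp_projSnd hj)
    exact ⟨C, hC, M, fun t ht u =>
      norm_le_of_norm_fderivComp_projSnd_le hf (h.1 (by omega) t) hC.le (hb t ht) u⟩

theorem fderiv_rescaleSnd (j : ℕ) {s : ℝ} (hs : s ≠ 0) {f : X × Y → F} (hf : ContDiff ℝ ∞ f) :
    fderiv ℝ (rescaleSnd j s f) = rescaleSnd j s (fderivComp (projFst X Y) f) +
      (s * s⁻¹ ^ j * s ^ (j - 1)) • rescaleSnd (j - 1) s (fderivComp (projSnd X Y) f) := by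
  ext1 p
  have h1 : HasFDerivAt (fun p : X × Y => (p.1, s • p.2))
      (projFst X Y + s • projSnd X Y) p := by
    have : (fun p : X × Y => (p.1, s • p.2)) = ⇑(projFst X Y + s • projSnd X Y) := by
      ext p <;> simp
    rw [this]
    exact (projFst X Y + s • projSnd X Y).hasFDerivAt
  have h2 := ((hf.differentiable (by simp) (p.1, s • p.2)).hasFDerivAt.comp p h1).const_smul
    (s⁻¹ ^ j)
  have h3 : fderiv ℝ (rescaleSnd j s f) p = _ := h2.fderiv
  rw [h3]
  have hc : s * s⁻¹ ^ j * s ^ (j - 1) * s⁻¹ ^ (j - 1) = s⁻¹ ^ j * s := by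
    rw [mul_assoc, ← mul_pow, mul_inv_cancel₀ hs, one_pow]
    ring
  simp only [Pi.add_apply, Pi.smul_apply, rescaleSnd, fderivComp, smul_smul, hc,
    ContinuousLinearMap.comp_add, ContinuousLinearMap.comp_smul, smul_add]

theorem VanishesOnZeroSection.exists_iteratedFDeriv_rescaleSnd_le (m : ℕ) {j : ℕ} (hj : j ≤ 2)
    {f : X × Y → F} (hf : ContDiff ℝ ∞ f) (hT : TemperateInSnd f)
    (h : VanishesOnZeroSection j f) {K : Set X} (hK : IsCompact K) :
    ∃ C > 0, ∃ M : ℕ, ∀ s ∈ Ioc (0 : ℝ) 1, ∀ t ∈ K, ∀ v : Y,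
      ‖iteratedFDeriv ℝ m (rescaleSnd j s f) (t, v)‖ ≤ C * (1 + ‖v‖) ^ M := by
  induction m generalizing F j with
  | zero =>
    obtain ⟨C, hC, M, hb⟩ := h.exists_norm_le hj hf hT hK
    refine ⟨C, hC, j + M, fun s hs t ht v => ?_⟩
    have hs0 : 0 < s := hs.1
    rw [norm_iteratedFDeriv_zero, rescaleSnd, norm_smul, norm_pow, norm_inv,
      Real.norm_of_nonneg hs0.le]
    have h1 : ‖s • v‖ = s * ‖v‖ := by rw [norm_smul, Real.norm_of_nonneg hs0.le]
    have h2 : s * ‖v‖ ≤ ‖v‖ := mul_le_of_le_one_left (norm_nonneg v) hs.2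
    calc _ ≤ s⁻¹ ^ j * (C * ‖s • v‖ ^ j * (1 + ‖s • v‖) ^ M) := by
          gcongr
          exact hb t ht (s • v)
      _ = (s⁻¹ * s) ^ j * (C * ‖v‖ ^ j * (1 + s * ‖v‖) ^ M) := by
          rw [h1]
          ring
      _ ≤ C * (1 + ‖v‖) ^ j * (1 + ‖v‖) ^ M := by
          rw [inv_mul_cancel₀ hs0.ne', one_pow, one_mul]
          gcongr
          linarith
      _ = _ := by ring
  | succ m ih =>
    have hf1 := contDiff_fderivComp (projFst X Y) hf
    have hf2 := contDiff_fderivComp (projSnd X Y) hf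
    obtain ⟨C₁, hC₁, M₁, hb₁⟩ := ih hj hf1 (hT.fderivComp _ hf) (h.fderivComp_projFst hf)
    obtain ⟨C₂, hC₂, M₂, hb₂⟩ := ih (by omega) hf2 (hT.fderivComp _ hf) (h.fderivComp_projSnd hj)
    refine ⟨C₁ + C₂, by positivity, M₁ + M₂, fun s hs t ht v => ?_⟩
    have hs0 : 0 < s := hs.1
    have hv : 1 ≤ 1 + ‖v‖ := by simp
    have hle (g : X × Y → X × Y →L[ℝ] F) (hg : ContDiff ℝ ∞ g) (i : ℕ) :
        ContDiffAt ℝ m (rescaleSnd i s g) (t, v) :=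
      ((contDiff_rescaleSnd i s hg).of_le (by exact_mod_cast le_top)).contDiffAt
    have hsmul (c : ℝ) (g : X × Y → X × Y →L[ℝ] F) (hg : ContDiffAt ℝ m g (t, v)) :
        ContDiffAt ℝ m (c • g) (t, v) := hg.const_smul c
    have hc : ‖s * s⁻¹ ^ j * s ^ (j - 1)‖ ≤ 1 := by
      rw [Real.norm_of_nonneg (by positivity)]
      rcases j with _ | j
      · simpa using hs.2
      · have : s * s⁻¹ ^ (j + 1) * s ^ (j + 1 - 1) = (s * s⁻¹) ^ (j + 1) := by
          simp only [Nat.add_sub_cancel]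
          ring
        rw [this, mul_inv_cancel₀ hs0.ne', one_pow]
    rw [← norm_iteratedFDeriv_fderiv, fderiv_rescaleSnd j hs0.ne' hf,
      iteratedFDeriv_add_apply (hle _ hf1 _)
        (hsmul _ _ (hle _ hf2 _)),
      iteratedFDeriv_const_smul_apply (hle _ hf2 _)]
    calc _ ≤ _ := norm_add_le _ _
      _ ≤ C₁ * (1 + ‖v‖) ^ M₁ + 1 * (C₂ * (1 + ‖v‖) ^ M₂) := by
          rw [norm_smul]
          gcongr
          · exact hb₁ s hs t ht v
          · exact hb₂ s hs t ht v
      _ ≤ C₁ * (1 + ‖v‖) ^ (M₁ + M₂) + 1 * (C₂ * (1 + ‖v‖) ^ (M₁ + M₂)) := by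
          gcongr <;> omega
      _ = _ := by ring

/-- A bound on each derivative gives a common bound on all derivatives up to a fixed order. -/
theorem exists_forall_le_iteratedFDeriv_le {ι : Type*} {S : Set ι} {K : Set X}
    {ψ : ι → X × Y → F}
    (h : ∀ m : ℕ, ∃ C > 0, ∃ M : ℕ, ∀ s ∈ S, ∀ t ∈ K, ∀ v : Y,
      ‖iteratedFDeriv ℝ m (ψ s) (t, v)‖ ≤ C * (1 + ‖v‖) ^ M) (m : ℕ) :
    ∃ C ≥ 1, ∃ M : ℕ, ∀ i ≤ m, ∀ s ∈ S, ∀ t ∈ K, ∀ v : Y,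
      ‖iteratedFDeriv ℝ i (ψ s) (t, v)‖ ≤ C * (1 + ‖v‖) ^ M := by
  choose C hC M hb using h
  have hpos : 0 ≤ ∑ i ∈ Finset.range (m + 1), C i := Finset.sum_nonneg fun i _ => (hC i).le
  refine ⟨1 + ∑ i ∈ Finset.range (m + 1), C i, by linarith,
    ∑ i ∈ Finset.range (m + 1), M i, fun i hi s hs t ht v => (hb i s hs t ht v).trans ?_⟩
  have hi' : i ∈ Finset.range (m + 1) := by simp; omega
  have h1 : C i ≤ ∑ i ∈ Finset.range (m + 1), C i :=
    Finset.single_le_sum (fun i _ => (hC i).le) hi'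
  have h2 : M i ≤ ∑ i ∈ Finset.range (m + 1), M i :=
    Finset.single_le_sum (fun i _ => Nat.zero_le _) hi'
  gcongr
  · linarith
  · simp

end PhaseRescaling

theorem contDiff_cexp_ofReal_mul_I :
    ContDiff ℝ ∞ (fun x : ℝ => Complex.exp (x * Complex.I)) :=
  (Complex.ofRealCLM.contDiff.mul contDiff_const).cexp

theorem norm_iteratedFDeriv_cexp_ofReal_mul_I (n : ℕ) (x : ℝ) :
    ‖iteratedFDeriv ℝ n (fun x : ℝ => Complex.exp (x * Complex.I)) x‖ = 1 := by
  have h : ∀ n : ℕ, iteratedDeriv n (fun x : ℝ => Complex.exp (x * Complex.I)) =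
      fun x : ℝ => Complex.I ^ n * Complex.exp (x * Complex.I) := by
    intro n
    induction n with
    | zero => simp
    | succ n ih =>
      rw [iteratedDeriv_succ, ih]
      ext x
      have h1 : HasDerivAt (fun x : ℝ => (x : ℂ) * Complex.I) (1 * Complex.I) x :=
        (Complex.ofRealCLM.hasDerivAt (x := x)).mul_const Complex.I
      rw [(h1.cexp.const_mul (Complex.I ^ n)).deriv]
      ring
  rw [norm_iteratedFDeriv_eq_norm_iteratedDeriv, h]
  simp [Complex.norm_exp_ofReal_mul_I]

/-- Derivatives of a product of a unimodular exponential with a smooth function. -/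
theorem norm_iteratedFDeriv_cexp_mul_le {E : Type*} [NormedAddCommGroup E] [NormedSpace ℝ E]
    {ψ : E → ℝ} {a : E → ℂ} (hψ : ContDiff ℝ ∞ ψ) (ha : ContDiff ℝ ∞ a) {m : ℕ} {x : E}
    {D A : ℝ} (hD : 1 ≤ D) (hψD : ∀ i ≤ m, ‖iteratedFDeriv ℝ i ψ x‖ ≤ D)
    (haA : ∀ i ≤ m, ‖iteratedFDeriv ℝ i a x‖ ≤ A) :
    ‖iteratedFDeriv ℝ m (fun p => Complex.exp (ψ p * Complex.I) * a p) x‖ ≤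
      2 ^ m * m.factorial * D ^ m * A := by
  have he : ∀ i ≤ m, ‖iteratedFDeriv ℝ i (fun p => Complex.exp (ψ p * Complex.I)) x‖ ≤
      m.factorial * D ^ m := by
    intro i hi
    have h1 := norm_iteratedFDeriv_comp_le contDiff_cexp_ofReal_mul_I hψ (n := i)
      (by exact_mod_cast le_top) x (C := 1) (D := D)
      (fun n _ => (norm_iteratedFDeriv_cexp_ofReal_mul_I n _).le)
      (fun n hn hni => (hψD n (hni.trans hi)).trans (le_self_pow₀ hD (by omega)))
    calc _ ≤ i.factorial * 1 * D ^ i := h1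
      _ ≤ m.factorial * D ^ m := by
        rw [mul_one]
        gcongr
  have hA : 0 ≤ A := (norm_nonneg _).trans (haA 0 (Nat.zero_le _))
  calc _ ≤ _ := norm_iteratedFDeriv_mul_le (N := ∞)
        (contDiff_cexp_ofReal_mul_I.comp hψ) ha x (by exact_mod_cast le_top)
    _ ≤ ∑ i ∈ Finset.range (m + 1), (m.choose i : ℝ) * (m.factorial * D ^ m) * A := by
        gcongr with i hi
        · exact he i (by simpa [Nat.lt_succ_iff] using hi)
        · exact haA _ (Nat.sub_le _ _)
    _ = (∑ i ∈ Finset.range (m + 1), (m.choose i : ℝ)) * (m.factorial * D ^ m) * A := by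
        simp_rw [Finset.sum_mul]
    _ = _ := by
        rw [← Nat.cast_sum, Nat.sum_range_choose]
        push_cast
        ring

/-- Multiplication by `e^{iφ/hbar}` preserves the model isotropic class:
if `φ(t,0) = 0`, `∂φ/∂u_r(t,0) = 0`, `φ` has temperate growth in `u` locally uniformly
in `t`, and `a` is Schwartz in the second variable locally uniformly in the first, then
(i) `e^{iφ(t,u)/hbar} a(t, u/√hbar) = c_hbar(t, u/√hbar)` with
`c_hbar(t,v) = e^{iφ(t,√hbar v)/hbar} a(t,v)`, and
(ii) the family `c_hbar` satisfies the same Schwartz-type estimates uniformly in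
`hbar ∈ (0,1]`. -/
theorem phase_multiplication_preserves_model_class (k l : ℕ)
    (φ : (Fin k → ℝ) × (Fin l → ℝ) → ℝ)
    (hφ : ContDiff ℝ (⊤ : ℕ∞) φ)
    (hφ0 : ∀ t : Fin k → ℝ, φ (t, 0) = 0)
    (hφ1 : ∀ (t : Fin k → ℝ) (r : Fin l),
      fderiv ℝ φ (t, 0) (0, Pi.single r 1) = 0)
    (hφtemp : ∀ (m : ℕ) (K : Set (Fin k → ℝ)), IsCompact K →
      ∃ C > 0, ∃ M : ℕ, ∀ t ∈ K, ∀ u : Fin l → ℝ,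
        ‖iteratedFDeriv ℝ m φ (t, u)‖ ≤ C * (1 + ‖u‖) ^ M)
    (a : (Fin k → ℝ) × (Fin l → ℝ) → ℂ)
    (ha : ContDiff ℝ (⊤ : ℕ∞) a)
    (haS : ∀ (m N : ℕ) (K : Set (Fin k → ℝ)), IsCompact K →
      ∃ C > 0, ∀ t ∈ K, ∀ v : Fin l → ℝ,
        ‖iteratedFDeriv ℝ m a (t, v)‖ * (1 + ‖v‖) ^ N ≤ C) :
    (∀ hbar ∈ Set.Ioc (0 : ℝ) 1, ∀ (t : Fin k → ℝ) (u : Fin l → ℝ),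
      Complex.exp (Complex.I * (φ (t, u) : ℂ) / (hbar : ℂ)) *
          a (t, (Real.sqrt hbar)⁻¹ • u)
        = (fun p : (Fin k → ℝ) × (Fin l → ℝ) =>
            Complex.exp (Complex.I * (φ (p.1, Real.sqrt hbar • p.2) : ℂ) / (hbar : ℂ)) *
              a p) (t, (Real.sqrt hbar)⁻¹ • u))
    ∧ (∀ (m N : ℕ) (K : Set (Fin k → ℝ)), IsCompact K →
        ∃ C > 0, ∀ hbar ∈ Set.Ioc (0 : ℝ) 1, ∀ t ∈ K, ∀ v : Fin l → ℝ,
          ‖iteratedFDeriv ℝ m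
              (fun p : (Fin k → ℝ) × (Fin l → ℝ) =>
                Complex.exp
                    (Complex.I * (φ (p.1, Real.sqrt hbar • p.2) : ℂ) / (hbar : ℂ)) *
                  a p) (t, v)‖ * (1 + ‖v‖) ^ N ≤ C) := by
  refine ⟨fun hbar hh t u => ?_, fun m N K hK => ?_⟩
  · have hs : Real.sqrt hbar ≠ 0 := (Real.sqrt_pos.2 hh.1).ne'
    simp [smul_smul, hs]
  have hV : VanishesOnZeroSection 2 φ := by
    refine ⟨fun _ => hφ0, fun _ t => ?_⟩
    ext w
    · simpa using fderiv_apply_fst_eq_zero hφ hφ0 t _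
    · have : (fderiv ℝ φ (t, 0)).comp (ContinuousLinearMap.inr ℝ (Fin k → ℝ) (Fin l → ℝ)) = 0 := by
        refine ContinuousLinearMap.coe_injective (LinearMap.pi_ext' fun r => ?_)
        ext
        simpa using hφ1 t r
      simpa using DFunLike.congr_fun this w
  obtain ⟨C, hC, M, hψ⟩ := exists_forall_le_iteratedFDeriv_le
    (fun m => hV.exists_iteratedFDeriv_rescaleSnd_le m le_rfl hφ hφtemp hK) m
  choose B hB hBa using fun i => haS i (N + M * m) K hK
  set A := ∑ i ∈ Finset.range (m + 1), B i
  have hA : 0 ≤ A := Finset.sum_nonneg fun i _ => (hB i).le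
  refine ⟨2 ^ m * m.factorial * C ^ m * A + 1, by positivity, fun hbar hh t ht v => ?_⟩
  have hs : Real.sqrt hbar ∈ Ioc (0 : ℝ) 1 :=
    ⟨Real.sqrt_pos.2 hh.1, Real.sqrt_le_one.2 hh.2⟩
  have hv : 1 ≤ 1 + ‖v‖ := by simp
  have hphase : (fun p : (Fin k → ℝ) × (Fin l → ℝ) =>
      Complex.exp (Complex.I * (φ (p.1, Real.sqrt hbar • p.2) : ℂ) / (hbar : ℂ)) * a p) =
      fun p => Complex.exp (rescaleSnd 2 (Real.sqrt hbar) φ p * Complex.I) * a p := by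
    ext p
    have : (Real.sqrt hbar)⁻¹ ^ 2 = hbar⁻¹ := by rw [inv_pow, Real.sq_sqrt hh.1.le]
    rw [rescaleSnd, this, smul_eq_mul]
    push_cast
    ring_nf
  have haA : ∀ i ≤ m, ‖iteratedFDeriv ℝ i a (t, v)‖ ≤ A / (1 + ‖v‖) ^ (N + M * m) := by
    intro i hi
    rw [le_div_iff₀ (by positivity)]
    exact (hBa i t ht v).trans (Finset.single_le_sum (fun i _ => (hB i).le)
      (Finset.mem_range.2 (Nat.lt_succ_of_le hi)))
  rw [hphase]
  have key := norm_iteratedFDeriv_cexp_mul_le (contDiff_rescaleSnd 2 (Real.sqrt hbar) hφ) ha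
    (one_le_mul_of_one_le_of_one_le hC (one_le_pow₀ hv))
    (fun i hi => hψ i hi _ hs t ht v) haA
  calc _ ≤ (2 ^ m * m.factorial * (C * (1 + ‖v‖) ^ M) ^ m * (A / (1 + ‖v‖) ^ (N + M * m))) *
        (1 + ‖v‖) ^ N := by gcongr
    _ = 2 ^ m * m.factorial * C ^ m * A := by
        rw [mul_pow, ← pow_mul, pow_add]
        field_simp
    _ ≤ _ := by linarith
end

section
/- Let n = k + l and write points of ℝ^{2n} as (t,u,τ,μ) with t,τ ∈ ℝ^k and u,μ ∈ ℝ^l. For infinitely differentiable f, g : ℝ^{2n} → ℝ define the Poisson bracket {f,g} = Σ_{j=1}^k (∂f/∂τ_j ∂g/∂t_j − ∂f/∂t_j ∂g/∂τ_j) + Σ_{j=1}^l (∂f/∂μ_j ∂g/∂u_j − ∂f/∂u_j ∂g/∂μ_j). Let 𝒫 be the set of infinitely differentiable f : ℝ^{2n} → ℝ such that for all t ∈ ℝ^k: f(t,0,0,0) = 0, and ∂f/∂u_j(t,0,0,0) = 0 and ∂f/∂μ_j(t,0,0,0) = 0 for j = 1,…,l. Then: (a) if f, g ∈ 𝒫 then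 {f,g} ∈ 𝒫; and (b) if f ∈ 𝒫 and g : ℝ^{2n} → ℝ is infinitely differentiable, then the product f·g ∈ 𝒫. -/
/-- The Poisson bracket on `T^*ℝ^n = (ℝ^k × ℝ^l) × (ℝ^k × ℝ^l)` (points `(t,u;τ,μ)`):
`{f,g} = Σ_j (∂f/∂τ_j ∂g/∂t_j − ∂f/∂t_j ∂g/∂τ_j)
       + Σ_j (∂f/∂μ_j ∂g/∂u_j − ∂f/∂u_j ∂g/∂μ_j)`. -/
noncomputable def poissonBracket (k l : ℕ)
    (f g : ((Fin k → ℝ) × (Fin l → ℝ)) × ((Fin k → ℝ) × (Fin l → ℝ)) → ℝ)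
    (x : ((Fin k → ℝ) × (Fin l → ℝ)) × ((Fin k → ℝ) × (Fin l → ℝ))) : ℝ :=
  (∑ j : Fin k,
      (fderiv ℝ f x ((0, 0), (Pi.single j 1, 0)) *
          fderiv ℝ g x ((Pi.single j 1, 0), (0, 0)) -
        fderiv ℝ f x ((Pi.single j 1, 0), (0, 0)) *
          fderiv ℝ g x ((0, 0), (Pi.single j 1, 0))))
  + ∑ j : Fin l,
      (fderiv ℝ f x ((0, 0), (0, Pi.single j 1)) *
          fderiv ℝ g x ((0, Pi.single j 1), (0, 0)) -
        fderiv ℝ f x ((0, Pi.single j 1), (0, 0)) *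
          fderiv ℝ g x ((0, 0), (0, Pi.single j 1)))

/-- Membership in `𝒫(Σ₀)`: `f` is `C^∞`, vanishes on the model isotropic
`Σ₀ = {(t,0;0,0)}`, and its Hamilton vector field is tangent to `Σ₀`
(equivalently all `u`- and `μ`-partials of `f` vanish on `Σ₀`). -/
def memPIsotropic (k l : ℕ)
    (f : ((Fin k → ℝ) × (Fin l → ℝ)) × ((Fin k → ℝ) × (Fin l → ℝ)) → ℝ) : Prop :=
  ContDiff ℝ (⊤ : ℕ∞) f ∧
  (∀ t : Fin k → ℝ, f ((t, 0), (0, 0)) = 0) ∧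
  (∀ (t : Fin k → ℝ) (j : Fin l),
    fderiv ℝ f ((t, 0), (0, 0)) ((0, Pi.single j 1), (0, 0)) = 0) ∧
  (∀ (t : Fin k → ℝ) (j : Fin l),
    fderiv ℝ f ((t, 0), (0, 0)) ((0, 0), (0, Pi.single j 1)) = 0)

section FDerivApply

variable {E : Type*} [NormedAddCommGroup E] [NormedSpace ℝ E]

theorem ContDiff.fderiv_apply_const {f : E → ℝ} (hf : ContDiff ℝ (⊤ : ℕ∞) f) (v : E) :
    ContDiff ℝ (⊤ : ℕ∞) (fun x => fderiv ℝ f x v) :=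
  (hf.fderiv_right (by simp)).clm_apply contDiff_const

/-- Directional derivatives of a smooth function commute. -/
theorem ContDiff.fderiv_fderiv_apply_comm {f : E → ℝ} (hf : ContDiff ℝ (⊤ : ℕ∞) f)
    (x v w : E) :
    fderiv ℝ (fun y => fderiv ℝ f y v) x w = fderiv ℝ (fun y => fderiv ℝ f y w) x v := by
  have hd : DifferentiableAt ℝ (fderiv ℝ f) x :=
    (hf.fderiv_right (m := (⊤ : ℕ∞)) (by simp)).differentiable (by simp) x
  have key : ∀ a b : E,
      fderiv ℝ (fun y => fderiv ℝ f y a) x b = fderiv ℝ (fderiv ℝ f) x b a := by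
    intro a b
    rw [fderiv_clm_apply hd (differentiableAt_const a)]
    simp
  rw [key, key]
  exact hf.contDiffAt.isSymmSndFDerivAt
    (by simpa using WithTop.coe_le_coe.2 (le_top : (2 : ℕ∞) ≤ ⊤)) w v

/-- A function vanishing on the range of a linear map has zero derivative along that range. -/
theorem fderiv_apply_eq_zero_of_comp_eq_zero {F : Type*} [NormedAddCommGroup F]
    [NormedSpace ℝ F] {h : E → ℝ} (L : F →L[ℝ] E) (hL : ∀ t, h (L t) = 0) {t : F}
    (hd : DifferentiableAt ℝ h (L t)) (w : F) : fderiv ℝ h (L t) (L w) = 0 := by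
  have hc := hd.hasFDerivAt.comp t L.hasFDerivAt
  have h0 : h ∘ L = fun _ => 0 := funext hL
  rw [h0] at hc
  exact DFunLike.congr_fun (hc.unique (hasFDerivAt_const 0 t)) w

end FDerivApply

section MemPIsotropic

variable {k l : ℕ} {f g : ((Fin k → ℝ) × (Fin l → ℝ)) × ((Fin k → ℝ) × (Fin l → ℝ)) → ℝ}

theorem fderiv_tangent_eq_zero (hf : ContDiff ℝ (⊤ : ℕ∞) f)
    (h0 : ∀ t : Fin k → ℝ, f ((t, 0), (0, 0)) = 0) (t w : Fin k → ℝ) :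
    fderiv ℝ f ((t, 0), (0, 0)) ((w, 0), (0, 0)) = 0 :=
  fderiv_apply_eq_zero_of_comp_eq_zero
    ((ContinuousLinearMap.inl ℝ ((Fin k → ℝ) × (Fin l → ℝ)) ((Fin k → ℝ) × (Fin l → ℝ))).comp
      (ContinuousLinearMap.inl ℝ (Fin k → ℝ) (Fin l → ℝ))) h0
    (hf.differentiable (by simp) _) w

theorem memPIsotropic.sub (hf : memPIsotropic k l f) (hg : memPIsotropic k l g) :
    memPIsotropic k l (fun x => f x - g x) := by
  obtain ⟨hfs, hf0, hfu, hfm⟩ := hf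
  obtain ⟨hgs, hg0, hgu, hgm⟩ := hg
  have hfd := hfs.differentiable (by simp)
  have hgd := hgs.differentiable (by simp)
  refine ⟨hfs.sub hgs, fun t => by simp [hf0, hg0], fun t j => ?_, fun t j => ?_⟩ <;>
    rw [fderiv_fun_sub (hfd _) (hgd _)] <;> simp [hfu, hgu, hfm, hgm]

theorem memPIsotropic.add (hf : memPIsotropic k l f) (hg : memPIsotropic k l g) :
    memPIsotropic k l (fun x => f x + g x) := by
  obtain ⟨hfs, hf0, hfu, hfm⟩ := hf
  obtain ⟨hgs, hg0, hgu, hgm⟩ := hg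
  have hfd := hfs.differentiable (by simp)
  have hgd := hgs.differentiable (by simp)
  refine ⟨hfs.add hgs, fun t => by simp [hf0, hg0], fun t j => ?_, fun t j => ?_⟩ <;>
    rw [fderiv_fun_add (hfd _) (hgd _)] <;> simp [hfu, hgu, hfm, hgm]

theorem memPIsotropic.sum {ι : Type*} (s : Finset ι)
    {F : ι → ((Fin k → ℝ) × (Fin l → ℝ)) × ((Fin k → ℝ) × (Fin l → ℝ)) → ℝ}
    (hF : ∀ i ∈ s, memPIsotropic k l (F i)) :
    memPIsotropic k l (fun x => ∑ i ∈ s, F i x) := by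
  have hd : ∀ x, ∀ i ∈ s, DifferentiableAt ℝ (F i) x := fun x i hi =>
    (hF i hi).1.differentiable (by simp) x
  refine ⟨ContDiff.sum fun i hi => (hF i hi).1,
    fun t => Finset.sum_eq_zero fun i hi => (hF i hi).2.1 t, fun t j => ?_, fun t j => ?_⟩ <;>
    rw [fderiv_fun_sum (hd _), _root_.sum_apply]
  · exact Finset.sum_eq_zero fun i hi => (hF i hi).2.2.1 t j
  · exact Finset.sum_eq_zero fun i hi => (hF i hi).2.2.2 t j

theorem memPIsotropic.mul_contDiff (hf : memPIsotropic k l f) (hg : ContDiff ℝ (⊤ : ℕ∞) g) :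
    memPIsotropic k l (fun x => f x * g x) := by
  obtain ⟨hfs, hf0, hfu, hfm⟩ := hf
  have hfd := hfs.differentiable (by simp)
  have hgd := hg.differentiable (by simp)
  refine ⟨hfs.mul hg, fun t => by simp [hf0], fun t j => ?_, fun t j => ?_⟩ <;>
    rw [fderiv_fun_mul (hfd _) (hgd _)] <;> simp [hf0, hfu, hfm]

/-- The square of the ideal of functions vanishing on the model isotropic lies in `𝒫(Σ₀)`. -/
theorem memPIsotropic_mul_of_vanish (hf : ContDiff ℝ (⊤ : ℕ∞) f)
    (hg : ContDiff ℝ (⊤ : ℕ∞) g) (hf0 : ∀ t : Fin k → ℝ, f ((t, 0), (0, 0)) = 0)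
    (hg0 : ∀ t : Fin k → ℝ, g ((t, 0), (0, 0)) = 0) :
    memPIsotropic k l (fun x => f x * g x) := by
  have hfd := hf.differentiable (by simp)
  have hgd := hg.differentiable (by simp)
  refine ⟨hf.mul hg, fun t => by simp [hf0], fun t j => ?_, fun t j => ?_⟩ <;>
    rw [fderiv_fun_mul (hfd _) (hgd _)] <;> simp [hf0, hg0]

/-- `𝒫(Σ₀)` is stable under derivatives in the directions tangent to `Σ₀`. -/
theorem memPIsotropic.fderiv_tangent (hf : memPIsotropic k l f) (w : Fin k → ℝ) :
    memPIsotropic k l (fun x => fderiv ℝ f x ((w, 0), (0, 0))) := by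
  obtain ⟨hfs, hf0, hfu, hfm⟩ := hf
  refine ⟨hfs.fderiv_apply_const _, fun t => fderiv_tangent_eq_zero hfs hf0 t w,
    fun t j => ?_, fun t j => ?_⟩ <;> rw [hfs.fderiv_fderiv_apply_comm]
  · exact fderiv_tangent_eq_zero (hfs.fderiv_apply_const _) (fun s => hfu s j) t w
  · exact fderiv_tangent_eq_zero (hfs.fderiv_apply_const _) (fun s => hfm s j) t w

theorem memPIsotropic.poissonBracket (hf : memPIsotropic k l f) (hg : memPIsotropic k l g) :
    memPIsotropic k l (poissonBracket k l f g) := by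
  have hfs := hf.1.fderiv_apply_const
  have hgs := hg.1.fderiv_apply_const
  refine memPIsotropic.add (memPIsotropic.sum _ fun j _ => memPIsotropic.sub ?_ ?_)
    (memPIsotropic.sum _ fun j _ => memPIsotropic.sub ?_ ?_)
  · simpa only [mul_comm] using (hg.fderiv_tangent (Pi.single j 1)).mul_contDiff (hfs _)
  · exact (hf.fderiv_tangent (Pi.single j 1)).mul_contDiff (hgs _)
  · exact memPIsotropic_mul_of_vanish (hfs _) (hgs _) (fun t => hf.2.2.2 t j)
      fun t => hg.2.2.1 t j
  · exact memPIsotropic_mul_of_vanish (hfs _) (hgs _) (fun t => hf.2.2.1 t j)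
      fun t => hg.2.2.2 t j

end MemPIsotropic

/-- `𝒫(Σ₀)` is a Poisson subalgebra of `C^∞(T^*ℝ^n)` and an ideal:
(a) it is closed under the Poisson bracket; (b) it absorbs products with arbitrary
smooth functions. -/
theorem isotropic_poisson_subalgebra_and_ideal (k l : ℕ) :
    (∀ f g : ((Fin k → ℝ) × (Fin l → ℝ)) × ((Fin k → ℝ) × (Fin l → ℝ)) → ℝ,
      memPIsotropic k l f → memPIsotropic k l g →
        memPIsotropic k l (poissonBracket k l f g))
    ∧ (∀ f g : ((Fin k → ℝ) × (Fin l → ℝ)) × ((Fin k → ℝ) × (Fin l → ℝ)) → ℝ,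
        memPIsotropic k l f → ContDiff ℝ (⊤ : ℕ∞) g →
          memPIsotropic k l (fun x => f x * g x)) :=
  ⟨fun _ _ hf hg => hf.poissonBracket hg, fun _ _ hf hg => hf.mul_contDiff hg⟩
end

section
/- Let k, l be natural numbers, r ∈ ℝ, K ⊂ ℝ^k a compact set, and C₀ > 0. Let a₀ : ℝ^k × ℝ^l → ℂ be continuous with a₀(t,v) = 0 for t ∉ K and |a₀(t,v)| ≤ C₀(1+‖v‖)^{−(l+1)} for all (t,v). Let a : ℝ^k × ℝ^l × (0,1] → ℂ be such that a(·,·,ħ) is continuous for each ħ, a(t,v,ħ) = 0 for t ∉ K, and |a(t,v,ħ) − ħ^r a₀(t,v)| ≤ C₀ ħ^{r+1/2}(1+‖v‖)^{−(l+1)} for all (t,v) and ħ ∈ (0,1]. Then there exists C' > 0 such that for all ħ ∈ (0,1], | ∫_{ℝ^k×ℝ^l} |a(t, u/√ħ, ħ)|² dt du − ħ^{2r+l/2} ∫_{ℝ^k×ℝ^l} |a₀(t,v)|² dt dv | ≤ C' ħ^{2r+(l+1)/2}. -/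
open MeasureTheory

/-- The indicator of `K` in the first variable times the decay `(1 + ‖v‖)^{-(l+1)}` in the
second. -/
noncomputable def decayWeight {k l : ℕ} (K : Set (Fin k → ℝ))
    (p : (Fin k → ℝ) × (Fin l → ℝ)) : ℝ :=
  K.indicator (fun _ => (1 : ℝ)) p.1 * ((1 + ‖p.2‖) ^ (l + 1))⁻¹

lemma decayWeight_nonneg {k l : ℕ} (K : Set (Fin k → ℝ)) (p : (Fin k → ℝ) × (Fin l → ℝ)) :
    0 ≤ decayWeight K p :=
  mul_nonneg (Set.indicator_nonneg (fun _ _ => zero_le_one) _) (by positivity)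

lemma decayWeight_le_one {k l : ℕ} (K : Set (Fin k → ℝ)) (p : (Fin k → ℝ) × (Fin l → ℝ)) :
    decayWeight K p ≤ 1 := by
  refine mul_le_one₀ (Set.indicator_le_self' (fun _ _ => zero_le_one) _) (by positivity) ?_
  exact inv_le_one_of_one_le₀ (one_le_pow₀ (by linarith [norm_nonneg p.2]))

lemma decayWeight_sq_le {k l : ℕ} (K : Set (Fin k → ℝ)) (p : (Fin k → ℝ) × (Fin l → ℝ)) :
    decayWeight K p ^ 2 ≤ decayWeight K p :=
  pow_le_of_le_one (decayWeight_nonneg K p) (decayWeight_le_one K p) two_ne_zero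

lemma decayWeight_inv_smul_le {k l : ℕ} (K : Set (Fin k → ℝ)) {c : ℝ} (hc : 0 < c) (hc1 : c ≤ 1)
    (p : (Fin k → ℝ) × (Fin l → ℝ)) :
    decayWeight K (p.1, c⁻¹ • p.2) ≤ decayWeight K p := by
  refine mul_le_mul_of_nonneg_left ?_ (Set.indicator_nonneg (fun _ _ => zero_le_one) _)
  have h : ‖p.2‖ ≤ ‖c⁻¹ • p.2‖ := by
    rw [norm_smul, Real.norm_of_nonneg (inv_nonneg.2 hc.le)]
    exact le_mul_of_one_le_left (norm_nonneg _) ((one_le_inv₀ hc).2 hc1)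
  gcongr

lemma integrable_decayWeight {k l : ℕ} {K : Set (Fin k → ℝ)} (hK : IsCompact K) :
    Integrable (decayWeight (l := l) K) := by
  have h1 : Integrable (K.indicator (fun _ => (1 : ℝ))) :=
    (integrable_indicator_iff hK.measurableSet).2 (integrableOn_const hK.measure_lt_top.ne)
  have h2 : Integrable (fun v : Fin l → ℝ => ((1 + ‖v‖) ^ (l + 1))⁻¹) := by
    have h := integrable_one_add_norm (E := Fin l → ℝ) (μ := volume) (r := (l + 1 : ℕ)) (by simp)
    refine h.congr (Filter.Eventually.of_forall fun v => ?_)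
    simp only
    rw [Real.rpow_neg (by positivity), Real.rpow_natCast]
  exact h1.mul_prod h2

lemma norm_le_decayWeight {k l : ℕ} {K : Set (Fin k → ℝ)}
    {f : (Fin k → ℝ) × (Fin l → ℝ) → ℂ} {M : ℝ}
    (hf : ∀ t v, t ∉ K → f (t, v) = 0)
    (hb : ∀ t v, ‖f (t, v)‖ ≤ M * ((1 + ‖v‖) ^ (l + 1))⁻¹) (p) :
    ‖f p‖ ≤ M * decayWeight K p := by
  obtain ⟨t, v⟩ := p
  by_cases ht : t ∈ K
  · simpa [decayWeight, ht] using hb t v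
  · simp [decayWeight, ht, hf t v ht]

lemma integrable_norm_sq_of_le_decayWeight {k l : ℕ} {K : Set (Fin k → ℝ)} (hK : IsCompact K)
    {f : (Fin k → ℝ) × (Fin l → ℝ) → ℂ} (hf : Continuous f) {M : ℝ}
    (hb : ∀ p, ‖f p‖ ≤ M * decayWeight K p) :
    Integrable (fun p => ‖f p‖ ^ 2) := by
  refine ((integrable_decayWeight hK).const_mul (M ^ 2)).mono'
    (hf.norm.pow 2).aestronglyMeasurable (Filter.Eventually.of_forall fun p => ?_)
  rw [Real.norm_of_nonneg (by positivity)]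
  calc ‖f p‖ ^ 2 ≤ (M * decayWeight K p) ^ 2 := by gcongr; exact hb p
    _ = M ^ 2 * decayWeight K p ^ 2 := by ring
    _ ≤ M ^ 2 * decayWeight K p := by gcongr; exact decayWeight_sq_le K p

lemma integral_prod_comp_inv_smul {k l : ℕ} {g : (Fin k → ℝ) × (Fin l → ℝ) → ℝ} {c : ℝ}
    (hc : 0 < c) (hg : Integrable g)
    (hgc : Integrable fun p : (Fin k → ℝ) × (Fin l → ℝ) => g (p.1, c⁻¹ • p.2)) :
    ∫ p : (Fin k → ℝ) × (Fin l → ℝ), g (p.1, c⁻¹ • p.2) = c ^ l * ∫ p, g p := by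
  have h1 := integral_prod (μ := (volume : Measure (Fin k → ℝ)))
    (ν := (volume : Measure (Fin l → ℝ))) _ hgc
  have h2 := integral_prod (μ := (volume : Measure (Fin k → ℝ)))
    (ν := (volume : Measure (Fin l → ℝ))) _ hg
  rw [Measure.volume_eq_prod, h1, h2, ← integral_const_mul]
  congr 1 with t
  have h := Measure.integral_comp_inv_smul_of_nonneg (volume : Measure (Fin l → ℝ))
    (fun v => g (t, v)) hc.le
  simpa using h

lemma abs_norm_sq_sub_norm_sq_le (x y : ℂ) :
    |‖x‖ ^ 2 - ‖y‖ ^ 2| ≤ ‖x - y‖ * (‖x - y‖ + 2 * ‖y‖) := by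
  have h : ‖x‖ + ‖y‖ ≤ ‖x - y‖ + 2 * ‖y‖ := by linarith [norm_sub_norm_le x y]
  rw [sq_sub_sq, abs_mul, abs_of_nonneg (by positivity : 0 ≤ ‖x‖ + ‖y‖), mul_comm]
  exact mul_le_mul (abs_norm_sub_norm_le x y) h (by positivity) (by positivity)

/-- Norm estimate for compactly supported model isotropic states:
`‖Υ‖²_{L²} = hbar^{2r+l/2} ∫ |a₀|² + O(hbar^{2r+(l+1)/2})`, where
`Υ(t,u,hbar) = a(t, hbar^{-1/2}u, hbar)` has leading amplitude `a₀`. -/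
theorem model_state_norm_estimate (k l : ℕ) (r : ℝ)
    (K : Set (Fin k → ℝ)) (hK : IsCompact K) (C₀ : ℝ) (hC₀ : 0 < C₀)
    (a₀ : (Fin k → ℝ) × (Fin l → ℝ) → ℂ)
    (ha₀c : Continuous a₀)
    (ha₀K : ∀ (t : Fin k → ℝ) (v : Fin l → ℝ), t ∉ K → a₀ (t, v) = 0)
    (ha₀b : ∀ (t : Fin k → ℝ) (v : Fin l → ℝ),
      ‖a₀ (t, v)‖ ≤ C₀ * ((1 + ‖v‖) ^ (l + 1))⁻¹)
    (a : (Fin k → ℝ) × (Fin l → ℝ) → ℝ → ℂ)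
    (hac : ∀ hbar ∈ Set.Ioc (0 : ℝ) 1, Continuous (fun p => a p hbar))
    (haK : ∀ (t : Fin k → ℝ) (v : Fin l → ℝ) (hbar : ℝ), t ∉ K → a (t, v) hbar = 0)
    (hab : ∀ (t : Fin k → ℝ) (v : Fin l → ℝ), ∀ hbar ∈ Set.Ioc (0 : ℝ) 1,
      ‖a (t, v) hbar - ((hbar ^ r : ℝ) : ℂ) * a₀ (t, v)‖ ≤
        C₀ * hbar ^ (r + 1 / 2) * ((1 + ‖v‖) ^ (l + 1))⁻¹) :
    ∃ C' > 0, ∀ hbar ∈ Set.Ioc (0 : ℝ) 1,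
      |(∫ p : (Fin k → ℝ) × (Fin l → ℝ),
            ‖a (p.1, (Real.sqrt hbar)⁻¹ • p.2) hbar‖ ^ 2) -
          hbar ^ (2 * r + l / 2) *
            ∫ p : (Fin k → ℝ) × (Fin l → ℝ), ‖a₀ p‖ ^ 2| ≤
        C' * hbar ^ (2 * r + (l + 1) / 2) := by
  have hI := integrable_decayWeight (l := l) hK
  have hI0 : 0 ≤ ∫ p, decayWeight (l := l) K p := integral_nonneg (decayWeight_nonneg K)
  refine ⟨3 * C₀ ^ 2 * (∫ p, decayWeight (l := l) K p) + 1, by positivity, ?_⟩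
  rintro h ⟨h0, h1⟩
  have hA : ∀ p, ‖a₀ p‖ ≤ C₀ * decayWeight K p := norm_le_decayWeight ha₀K ha₀b
  have hD : ∀ p, ‖a p h - ((h ^ r : ℝ) : ℂ) * a₀ p‖ ≤
      C₀ * h ^ (r + 1 / 2) * decayWeight K p :=
    norm_le_decayWeight (fun t v ht => by simp [haK t v h ht, ha₀K t v ht])
      (fun t v => hab t v h ⟨h0, h1⟩)
  have hr : 0 < h ^ r := Real.rpow_pos_of_pos h0 r
  have hB : ∀ p, ‖((h ^ r : ℝ) : ℂ) * a₀ p‖ ≤ C₀ * h ^ r * decayWeight K p := fun p => by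
    rw [norm_mul, Complex.norm_real, Real.norm_of_nonneg hr.le]
    nlinarith [mul_le_mul_of_nonneg_left (hA p) hr.le]
  have hle : h ^ (r + 1 / 2) ≤ h ^ r := Real.rpow_le_rpow_of_exponent_ge h0 h1 (by linarith)
  have hE : ∀ p, ‖a p h‖ ≤ (C₀ * h ^ (r + 1 / 2) + C₀ * h ^ r) * decayWeight K p := fun p => by
    linarith [norm_sub_norm_le (a p h) (((h ^ r : ℝ) : ℂ) * a₀ p), hD p, hB p]
  have hs : 0 < √h := Real.sqrt_pos.2 h0
  have hs1 : √h ≤ 1 := Real.sqrt_le_one.2 h1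
  have hcont := hac h ⟨h0, h1⟩
  have hIa := integrable_norm_sq_of_le_decayWeight hK hcont hE
  have hIas : Integrable (fun p : (Fin k → ℝ) × (Fin l → ℝ) => ‖a (p.1, (√h)⁻¹ • p.2) h‖ ^ 2) :=
    integrable_norm_sq_of_le_decayWeight hK
      (f := fun p : (Fin k → ℝ) × (Fin l → ℝ) => a (p.1, (√h)⁻¹ • p.2) h)
      (hcont.comp (by fun_prop : Continuous fun p : (Fin k → ℝ) × (Fin l → ℝ) =>
        (p.1, (√h)⁻¹ • p.2)))
      (fun p => (hE _).trans
        (mul_le_mul_of_nonneg_left (decayWeight_inv_smul_le K hs hs1 p) (by positivity)))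
  have hIb : Integrable (fun p => ‖((h ^ r : ℝ) : ℂ) * a₀ p‖ ^ 2) :=
    integrable_norm_sq_of_le_decayWeight hK (continuous_const.mul ha₀c) hB
  have hscale : (√h) ^ l = h ^ ((l : ℝ) / 2) := by
    rw [Real.sqrt_eq_rpow, ← Real.rpow_natCast, ← Real.rpow_mul h0.le]
    congr 1
    ring
  have hb_int : ∫ p, ‖((h ^ r : ℝ) : ℂ) * a₀ p‖ ^ 2 = h ^ (2 * r) * ∫ p, ‖a₀ p‖ ^ 2 := by
    rw [← integral_const_mul]
    congr 1 with p
    rw [norm_mul, Complex.norm_real, Real.norm_of_nonneg hr.le, mul_pow, two_mul,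
      Real.rpow_add h0, ← sq]
  have hbound : ∀ p, |‖a p h‖ ^ 2 - ‖((h ^ r : ℝ) : ℂ) * a₀ p‖ ^ 2| ≤
      3 * C₀ ^ 2 * h ^ (2 * r + 1 / 2) * decayWeight K p := fun p => by
    have hw := decayWeight_nonneg K p
    calc |‖a p h‖ ^ 2 - ‖((h ^ r : ℝ) : ℂ) * a₀ p‖ ^ 2|
        ≤ C₀ * h ^ (r + 1 / 2) * decayWeight K p *
          (C₀ * h ^ r * decayWeight K p + 2 * (C₀ * h ^ r * decayWeight K p)) := by
          refine (abs_norm_sq_sub_norm_sq_le _ _).trans ?_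
          gcongr
          · exact hD p
          · exact (hD p).trans (by gcongr)
          · exact hB p
      _ = 3 * C₀ ^ 2 * (h ^ (r + 1 / 2) * h ^ r) * decayWeight K p ^ 2 := by ring
      _ = 3 * C₀ ^ 2 * h ^ (2 * r + 1 / 2) * decayWeight K p ^ 2 := by
          rw [← Real.rpow_add h0]
          ring_nf
      _ ≤ _ := by
          gcongr
          exact decayWeight_sq_le K p
  have hmain : |(∫ p, ‖a p h‖ ^ 2) - ∫ p, ‖((h ^ r : ℝ) : ℂ) * a₀ p‖ ^ 2| ≤
      3 * C₀ ^ 2 * h ^ (2 * r + 1 / 2) * ∫ p, decayWeight (l := l) K p := by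
    rw [← integral_sub hIa hIb, ← integral_const_mul]
    rw [← Real.norm_eq_abs]
    exact norm_integral_le_of_norm_le (hI.const_mul _) (Filter.Eventually.of_forall hbound)
  rw [integral_prod_comp_inv_smul (g := fun p => ‖a p h‖ ^ 2) hs hIa hIas, hscale, add_comm (2 * r), Real.rpow_add h0,
    mul_assoc, ← hb_int, ← mul_sub, abs_mul, abs_of_pos (Real.rpow_pos_of_pos h0 _)]
  have hexp : h ^ (2 * r + ((l : ℝ) + 1) / 2) = h ^ ((l : ℝ) / 2) * h ^ (2 * r + 1 / 2) := by
    rw [← Real.rpow_add h0]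
    ring_nf
  rw [hexp]
  calc _ ≤ h ^ ((l : ℝ) / 2) *
        (3 * C₀ ^ 2 * h ^ (2 * r + 1 / 2) * ∫ p, decayWeight (l := l) K p) := by gcongr
    _ = 3 * C₀ ^ 2 * (∫ p, decayWeight (l := l) K p) *
        (h ^ ((l : ℝ) / 2) * h ^ (2 * r + 1 / 2)) := by ring
    _ ≤ _ := by gcongr; linarith
end

section
/- Let n, m be natural numbers, let ψ be a complex-valued Schwartz function on ℝ^m, let a : ℝ^n × ℝ^m → ℂ be infinitely differentiable with all partial derivatives bounded, and let q_{ij} : ℝ^n × ℝ^m → ℝ (1 ≤ i,j ≤ m) be infinitely differentiable with all partial derivatives bounded. For ħ ∈ (0,1], x ∈ ℝ^n, v ∈ ℝ^m define G(x,v,ħ) = ∫_{ℝ^m} e^{i⟨v,w⟩} a(x, √ħ w) exp( i Σ_{i,j=1}^m q_{ij}(x, √ħ w) w_i w_j ) ψ(w) dw. Then for every N ∈ ℕ there exists C > 0 such that for all ħ ∈ (0,1], all x ∈ ℝ^n and all v ∈ ℝ^m, |G(x,v,ħ)| ≤ C(1+‖v‖)^{−N}. -/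
open MeasureTheory

open scoped ContDiff

/-- A family of smooth functions all of whose derivatives grow at most polynomially,
uniformly in the family. -/
def UniformTemperateGrowth {ι E F : Type*} [NormedAddCommGroup E] [NormedSpace ℝ E]
    [NormedAddCommGroup F] [NormedSpace ℝ F] (f : ι → E → F) : Prop :=
  (∀ t, ContDiff ℝ ∞ (f t)) ∧
    ∀ j : ℕ, ∃ (k : ℕ) (C : ℝ), ∀ t x, ‖iteratedFDeriv ℝ j (f t) x‖ ≤ C * (1 + ‖x‖) ^ k

namespace UniformTemperateGrowth

variable {ι E F : Type*} [NormedAddCommGroup E] [NormedSpace ℝ E]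
  [NormedAddCommGroup F] [NormedSpace ℝ F]

theorem const {f : E → F} (hf : f.HasTemperateGrowth) :
    UniformTemperateGrowth (fun _ : ι ↦ f) :=
  ⟨fun _ ↦ hf.1, fun j ↦ let ⟨k, C, h⟩ := hf.2 j; ⟨k, C, fun _ ↦ h⟩⟩

theorem bound_of_le {f : ι → E → F} (hf : UniformTemperateGrowth f) (n : ℕ) :
    ∃ (k : ℕ) (C : ℝ), 0 ≤ C ∧ ∀ j ≤ n, ∀ t x,
      ‖iteratedFDeriv ℝ j (f t) x‖ ≤ C * (1 + ‖x‖) ^ k := by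
  choose k C h using hf.2
  refine ⟨∑ j ∈ Finset.range (n + 1), k j, ∑ j ∈ Finset.range (n + 1), |C j|,
    by positivity, fun j hj t x ↦ (h j t x).trans ?_⟩
  have hj' : j ∈ Finset.range (n + 1) := by simp; omega
  have h1 : (1 : ℝ) ≤ 1 + ‖x‖ := by simp
  gcongr
  · exact (le_abs_self _).trans
      (Finset.single_le_sum (f := fun j ↦ |C j|) (fun _ _ ↦ abs_nonneg _) hj')
  · exact Finset.single_le_sum (f := k) (fun _ _ ↦ Nat.zero_le _) hj'

theorem mul {A : Type*} [NormedRing A] [NormedAlgebra ℝ A] {f g : ι → E → A}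
    (hf : UniformTemperateGrowth f) (hg : UniformTemperateGrowth g) :
    UniformTemperateGrowth (fun t x ↦ f t x * g t x) := by
  refine ⟨fun t ↦ (hf.1 t).mul (hg.1 t), fun n ↦ ?_⟩
  obtain ⟨k, C, hC, h⟩ := hf.bound_of_le n
  obtain ⟨l, D, hD, h'⟩ := hg.bound_of_le n
  refine ⟨k + l, ∑ i ∈ Finset.range (n + 1), (n.choose i : ℝ) * C * D, fun t x ↦ ?_⟩
  refine (norm_iteratedFDeriv_mul_le (hf.1 t) (hg.1 t) x (mod_cast le_top)).trans ?_
  rw [Finset.sum_mul]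
  refine Finset.sum_le_sum fun i hi ↦ ?_
  calc _ ≤ (n.choose i : ℝ) * (C * (1 + ‖x‖) ^ k) * (D * (1 + ‖x‖) ^ l) := by
        gcongr
        · exact h i (by simp at hi; omega) t x
        · exact h' (n - i) (by omega) t x
    _ = _ := by ring

theorem sum {κ : Type*} {s : Finset κ} {f : κ → ι → E → F}
    (hf : ∀ i ∈ s, UniformTemperateGrowth (f i)) :
    UniformTemperateGrowth (fun t x ↦ ∑ i ∈ s, f i t x) := by
  refine ⟨fun t ↦ ContDiff.sum fun i hi ↦ (hf i hi).1 t, fun n ↦ ?_⟩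
  have H : ∀ i : κ, ∃ (k : ℕ) (C : ℝ), i ∈ s →
      (0 ≤ C ∧ ∀ t x, ‖iteratedFDeriv ℝ n (f i t) x‖ ≤ C * (1 + ‖x‖) ^ k) := by
    intro i
    by_cases hi : i ∈ s
    · obtain ⟨k, C, hC, h⟩ := (hf i hi).bound_of_le n
      exact ⟨k, C, fun _ ↦ ⟨hC, h n le_rfl⟩⟩
    · exact ⟨0, 0, fun h ↦ absurd h hi⟩
  choose k C h using H
  refine ⟨∑ i ∈ s, k i, ∑ i ∈ s, C i, fun t x ↦ ?_⟩
  rw [iteratedFDeriv_fun_sum_apply fun i hi ↦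
    (((hf i hi).1 t).of_le (mod_cast le_top)).contDiffAt, Finset.sum_mul]
  refine (norm_sum_le _ _).trans (Finset.sum_le_sum fun i hi ↦ ((h i hi).2 t x).trans ?_)
  have h1 : (1 : ℝ) ≤ 1 + ‖x‖ := by simp
  have := (h i hi).1
  gcongr
  · exact Finset.single_le_sum (f := k) (fun _ _ ↦ Nat.zero_le _) hi

theorem comp_of_bounded {G : Type*} [NormedAddCommGroup G] [NormedSpace ℝ G] {g : F → G}
    (hg : ContDiff ℝ ∞ g) (hgB : ∀ j : ℕ, ∃ C, ∀ y, ‖iteratedFDeriv ℝ j g y‖ ≤ C)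
    {f : ι → E → F} (hf : UniformTemperateGrowth f) :
    UniformTemperateGrowth (fun t x ↦ g (f t x)) := by
  refine ⟨fun t ↦ hg.comp (hf.1 t), fun n ↦ ?_⟩
  choose B hB using hgB
  obtain ⟨k, C, hC, h⟩ := hf.bound_of_le n
  refine ⟨k * n, n.factorial * (∑ j ∈ Finset.range (n + 1), |B j|) * (1 + C) ^ n,
    fun t x ↦ ?_⟩
  have h1 : (1 : ℝ) ≤ (1 + ‖x‖) ^ k := one_le_pow₀ (by simp)
  calc ‖iteratedFDeriv ℝ n (g ∘ f t) x‖
      ≤ n.factorial * (∑ j ∈ Finset.range (n + 1), |B j|) * ((1 + C) * (1 + ‖x‖) ^ k) ^ n := by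
        refine norm_iteratedFDeriv_comp_le hg (hf.1 t) (mod_cast le_top) x (fun i hi ↦ ?_)
          (fun i hi hi' ↦ ?_)
        · exact ((hB i _).trans (le_abs_self _)).trans
            (Finset.single_le_sum (f := fun j ↦ |B j|) (fun _ _ ↦ abs_nonneg _)
              (by simp; omega))
        · refine (h i hi' t x).trans ?_
          refine le_trans ?_ (le_self_pow₀ (one_le_mul_of_one_le_of_one_le (by linarith) h1)
            (by omega))
          gcongr
          linarith
    _ = _ := by rw [mul_pow, ← pow_mul]; ring

theorem of_bounded_comp_affine {G : Type*} [NormedAddCommGroup G] [NormedSpace ℝ G] {g : F → G}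
    (hg : ContDiff ℝ ∞ g) (hgB : ∀ j : ℕ, ∃ C, ∀ y, ‖iteratedFDeriv ℝ j g y‖ ≤ C)
    (c : ι → F) (L : ι → E →L[ℝ] F) (hL : ∀ t, ‖L t‖ ≤ 1) :
    UniformTemperateGrowth (fun t x ↦ g (c t + L t x)) := by
  have hgc : ∀ t, ContDiff ℝ ∞ (fun y ↦ g (c t + y)) := fun t ↦
    hg.comp (contDiff_const.add contDiff_id)
  refine ⟨fun t ↦ (hgc t).comp (L t).contDiff, fun n ↦ ?_⟩
  obtain ⟨C, hC⟩ := hgB n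
  refine ⟨0, C, fun t x ↦ ?_⟩
  have := (L t).iteratedFDeriv_comp_right (hgc t) x (i := n) (mod_cast le_top)
  rw [Function.comp_def] at this
  rw [this, iteratedFDeriv_comp_add_left, pow_zero, mul_one]
  refine (ContinuousMultilinearMap.norm_compContinuousLinearMap_le _ _).trans ?_
  refine le_trans ?_ (hC (c t + L t x))
  refine mul_le_of_le_one_right (norm_nonneg _) (Finset.prod_le_one ?_ ?_)
  · exact fun _ _ ↦ norm_nonneg _
  · exact fun _ _ ↦ hL t

theorem mul_schwartz {f : ι → E → ℂ} (hf : UniformTemperateGrowth f) (ψ : SchwartzMap E ℂ)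
    (r n : ℕ) :
    ∃ C : ℝ, ∀ t x, (1 + ‖x‖) ^ r * ‖iteratedFDeriv ℝ n (fun y ↦ f t y * ψ y) x‖ ≤ C := by
  obtain ⟨k, C, hC, h⟩ := hf.bound_of_le n
  let S : ℝ := 2 ^ (r + k) *
    ((Finset.Iic (r + k, n)).sup fun p ↦ SchwartzMap.seminorm ℝ p.1 p.2) ψ
  have hS : ∀ i ≤ n, ∀ x, (1 + ‖x‖) ^ (r + k) * ‖iteratedFDeriv ℝ i ψ x‖ ≤ S := fun i hi x ↦
    SchwartzMap.one_add_le_sup_seminorm_apply (𝕜 := ℝ) (m := (r + k, n)) le_rfl hi ψ x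
  refine ⟨∑ i ∈ Finset.range (n + 1), (n.choose i : ℝ) * C * S, fun t x ↦ ?_⟩
  refine (mul_le_mul_of_nonneg_left (norm_iteratedFDeriv_mul_le (hf.1 t) (ψ.smooth ⊤) x
    (mod_cast le_top)) (by positivity)).trans ?_
  rw [Finset.mul_sum]
  refine Finset.sum_le_sum fun i hi ↦ ?_
  calc _ ≤ (1 + ‖x‖) ^ r * ((n.choose i : ℝ) * (C * (1 + ‖x‖) ^ k) *
          ‖iteratedFDeriv ℝ (n - i) ψ x‖) := by
        gcongr
        exact h i (by simp at hi; omega) t x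
    _ = (n.choose i : ℝ) * C * ((1 + ‖x‖) ^ (r + k) * ‖iteratedFDeriv ℝ (n - i) ψ x‖) := by
        rw [pow_add]; ring
    _ ≤ _ := by
        gcongr
        exact hS _ (by omega) x

end UniformTemperateGrowth

theorem iteratedDeriv_cexp_I_mul_ofReal (n : ℕ) :
    iteratedDeriv n (fun s : ℝ ↦ Complex.exp (Complex.I * s)) =
      fun s : ℝ ↦ Complex.I ^ n * Complex.exp (Complex.I * s) := by
  induction n with
  | zero => simp
  | succ n ih =>
    rw [iteratedDeriv_succ, ih]
    ext s
    have h : HasDerivAt (fun s : ℝ ↦ Complex.I * (s : ℂ)) (Complex.I * 1) s :=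
      (Complex.ofRealCLM.hasDerivAt (x := s)).const_mul Complex.I
    rw [(h.cexp.const_mul _).deriv, pow_succ]
    ring

theorem norm_iteratedFDeriv_cexp_I_mul_ofReal (n : ℕ) (s : ℝ) :
    ‖iteratedFDeriv ℝ n (fun s : ℝ ↦ Complex.exp (Complex.I * s)) s‖ = 1 := by
  rw [norm_iteratedFDeriv_eq_norm_iteratedDeriv, iteratedDeriv_cexp_I_mul_ofReal]
  simp [mul_comm Complex.I, Complex.norm_exp_ofReal_mul_I]

/-- The pairing `(w, v) ↦ -(2π)⁻¹ ∑ i, v i * w i`, normalized so that the associated Fourier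
integral has kernel `exp (i ∑ i, v i * w i)`. -/
noncomputable def negDotPairing (m : ℕ) : (Fin m → ℝ) →L[ℝ] (Fin m → ℝ) →L[ℝ] ℝ :=
  (-(2 * Real.pi)⁻¹) • ∑ i, (ContinuousLinearMap.proj (R := ℝ) (φ := fun _ : Fin m ↦ ℝ) i).smulRight
    (ContinuousLinearMap.proj (R := ℝ) (φ := fun _ : Fin m ↦ ℝ) i)

theorem negDotPairing_apply {m : ℕ} (w v : Fin m → ℝ) :
    negDotPairing m w v = -(2 * Real.pi)⁻¹ * ∑ i, v i * w i := by
  simp [negDotPairing, mul_comm]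

theorem fourierIntegral_negDotPairing {m : ℕ} (f : (Fin m → ℝ) → ℂ) (v : Fin m → ℝ) :
    VectorFourier.fourierIntegral Real.fourierChar volume (negDotPairing m).toLinearMap₁₂ f v =
      ∫ w, Complex.exp (Complex.I * ((∑ i, v i * w i : ℝ) : ℂ)) * f w := by
  unfold VectorFourier.fourierIntegral
  congr 1 with w
  rw [Circle.smul_def, Real.fourierChar_apply, smul_eq_mul]
  congr 2
  have : 2 * Real.pi * -(negDotPairing m).toLinearMap₁₂ w v = ∑ i, v i * w i := by
    change 2 * Real.pi * -(negDotPairing m w v) = _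
    rw [negDotPairing_apply]
    field_simp
  rw [this, mul_comm]

/-- A pointwise decay bound on all derivatives, uniform over a family, yields uniform rapid decay
of the Fourier integrals. -/
theorem exists_oscillatory_integral_bound {ι : Type*} {m : ℕ} {f : ι → (Fin m → ℝ) → ℂ}
    (hf : ∀ t, ContDiff ℝ ∞ (f t))
    (hB : ∀ r n : ℕ, ∃ C : ℝ, ∀ t x, (1 + ‖x‖) ^ r * ‖iteratedFDeriv ℝ n (f t) x‖ ≤ C) (N : ℕ) :
    ∃ B : ℝ, 0 ≤ B ∧ ∀ t (u v : Fin m → ℝ), |∑ i, v i * u i| ^ N *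
      ‖∫ w, Complex.exp (Complex.I * ((∑ i, v i * w i : ℝ) : ℂ)) * f t w‖ ≤ ‖u‖ ^ N * B := by
  have hint : Integrable (fun x : Fin m → ℝ ↦ (1 + ‖x‖) ^ (-((m + 1 : ℕ) : ℝ))) :=
    integrable_one_add_norm (by simp)
  have hpt : ∀ k n : ℕ, ∃ C : ℝ, ∀ t x, ‖x‖ ^ k * ‖iteratedFDeriv ℝ n (f t) x‖ ≤
      C * (1 + ‖x‖) ^ (-((m + 1 : ℕ) : ℝ)) := by
    intro k n
    obtain ⟨C, hC⟩ := hB (k + (m + 1)) n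
    refine ⟨C, fun t x ↦ ?_⟩
    have hpos : 0 < 1 + ‖x‖ := by positivity
    rw [Real.rpow_neg hpos.le, Real.rpow_natCast, ← div_eq_mul_inv, le_div_iff₀ (by positivity)]
    refine le_trans ?_ (hC t x)
    calc _ = ‖x‖ ^ k * (1 + ‖x‖) ^ (m + 1) * ‖iteratedFDeriv ℝ n (f t) x‖ := by ring
      _ ≤ (1 + ‖x‖) ^ k * (1 + ‖x‖) ^ (m + 1) * ‖iteratedFDeriv ℝ n (f t) x‖ := by
          gcongr; linarith
      _ = _ := by rw [pow_add (1 + ‖x‖) k (m + 1)]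
  choose C hC using hpt
  have hI : ∀ t (k n : ℕ), Integrable (fun x ↦ ‖x‖ ^ k * ‖iteratedFDeriv ℝ n (f t) x‖) := by
    intro t k n
    refine (hint.const_mul (C k n)).mono' (Continuous.aestronglyMeasurable ?_) ?_
    · exact (continuous_norm.pow k).mul
        ((hf t).continuous_iteratedFDeriv (mod_cast le_top)).norm
    · filter_upwards with x
      rw [Real.norm_of_nonneg (by positivity)]
      exact hC k n t x
  let P : Finset (ℕ × ℕ) := Finset.range (0 + 1) ×ˢ Finset.range (N + 1)
  let J : ℝ := ∑ p ∈ P, ∫ x : Fin m → ℝ, C p.1 p.2 * (1 + ‖x‖) ^ (-((m + 1 : ℕ) : ℝ))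
  refine ⟨(2 * Real.pi) ^ N * 2 ^ N * |J|, by positivity, fun t u v ↦ ?_⟩
  have key := VectorFourier.pow_mul_norm_iteratedFDeriv_fourierIntegral_le (negDotPairing m)
    (μ := volume) (K := ⊤) (N := ⊤) (hf t) (fun k n _ _ ↦ hI t k n) (k := 0) (n := N)
    (by simp) (mod_cast le_top) u v
  rw [norm_iteratedFDeriv_zero, fourierIntegral_negDotPairing, negDotPairing_apply] at key
  have hJ : ∑ p ∈ P, ∫ x, ‖x‖ ^ p.1 * ‖iteratedFDeriv ℝ p.2 (f t) x‖ ≤ |J| :=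
    (Finset.sum_le_sum fun p _ ↦ integral_mono (hI t p.1 p.2) (hint.const_mul _)
      (hC p.1 p.2 t)).trans (le_abs_self J)
  have habs : |∑ i, v i * u i| = 2 * Real.pi * |-(2 * Real.pi)⁻¹ * ∑ i, v i * u i| := by
    rw [abs_mul, abs_neg, abs_of_pos (by positivity : 0 < (2 * Real.pi)⁻¹)]
    field_simp
  rw [habs, mul_pow, mul_assoc]
  calc _ ≤ (2 * Real.pi) ^ N * (‖u‖ ^ N * (2 * Real.pi * ‖negDotPairing m‖) ^ 0 *
          (2 * (0 : ℕ) + 2) ^ N * |J|) := by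
        refine mul_le_mul_of_nonneg_left (key.trans ?_) (by positivity)
        exact mul_le_mul_of_nonneg_left hJ (by positivity)
    _ = _ := by simp; ring

/-- Uniform rapid decay in terms of the norm of the frequency. -/
theorem exists_oscillatory_integral_decay {ι : Type*} {m : ℕ} {f : ι → (Fin m → ℝ) → ℂ}
    (hf : ∀ t, ContDiff ℝ ∞ (f t))
    (hB : ∀ r n : ℕ, ∃ C : ℝ, ∀ t x, (1 + ‖x‖) ^ r * ‖iteratedFDeriv ℝ n (f t) x‖ ≤ C) (N : ℕ) :
    ∃ B > 0, ∀ t (v : Fin m → ℝ),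
      ‖∫ w, Complex.exp (Complex.I * ((∑ i, v i * w i : ℝ) : ℂ)) * f t w‖ *
        (1 + ‖v‖) ^ N ≤ B := by
  obtain ⟨B₀, hB₀, h₀⟩ := exists_oscillatory_integral_bound hf hB 0
  obtain ⟨B₁, hB₁, h₁⟩ := exists_oscillatory_integral_bound hf hB N
  refine ⟨(B₀ + B₁ + 1) * 2 ^ N, by positivity, fun t v ↦ ?_⟩
  set G := ‖∫ w, Complex.exp (Complex.I * ((∑ i, v i * w i : ℝ) : ℂ)) * f t w‖ with hG
  have hG0 : 0 ≤ G := norm_nonneg _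
  rcases le_or_gt ‖v‖ 1 with hv | hv
  · have h : G ≤ B₀ := by simpa [hG] using h₀ t 0 v
    gcongr
    · linarith
    · linarith
  · have : Nonempty (Fin m) := by
      by_contra hne
      rw [not_nonempty_iff] at hne
      rw [Subsingleton.elim v 0, norm_zero] at hv
      linarith
    obtain ⟨i, hi⟩ := Finite.exists_max fun i ↦ ‖v i‖
    have hvi : ‖v‖ ≤ |v i| := (pi_norm_le_iff_of_nonneg (norm_nonneg _)).2 hi
    have h : |v i| ^ N * G ≤ B₁ := by
      simpa [hG, Pi.norm_single, Pi.single_apply] using h₁ t (Pi.single i 1) v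
    calc G * (1 + ‖v‖) ^ N ≤ G * (2 * |v i|) ^ N := by
          gcongr
          linarith
      _ = (|v i| ^ N * G) * 2 ^ N := by ring
      _ ≤ _ := by
          gcongr
          linarith

/-- Uniform rapid decay of the amplitude arising from applying a Fourier integral
operator to a coherent state: with `ψ` Schwartz, `a` and the `q_{ij}` smooth with all
derivatives bounded,
`G(x,v,hbar) = ∫ e^{i⟨v,w⟩} a(x,√hbar w) e^{iΣ q_{ij}(x,√hbar w) w_i w_j} ψ(w) dw`
satisfies `|G(x,v,hbar)| ≤ C_N (1+‖v‖)^{-N}` uniformly in `x` and `hbar ∈ (0,1]`. -/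
theorem fio_coherent_state_amplitude_decay (n m : ℕ)
    (ψ : SchwartzMap (Fin m → ℝ) ℂ)
    (a : (Fin n → ℝ) × (Fin m → ℝ) → ℂ)
    (ha : ContDiff ℝ (⊤ : ℕ∞) a)
    (haB : ∀ j : ℕ, ∃ C, ∀ x, ‖iteratedFDeriv ℝ j a x‖ ≤ C)
    (q : Fin m → Fin m → (Fin n → ℝ) × (Fin m → ℝ) → ℝ)
    (hq : ∀ i j, ContDiff ℝ (⊤ : ℕ∞) (q i j))
    (hqB : ∀ (i j : Fin m) (d : ℕ), ∃ C, ∀ x, ‖iteratedFDeriv ℝ d (q i j) x‖ ≤ C) :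
    ∀ N : ℕ, ∃ C > 0, ∀ hbar ∈ Set.Ioc (0 : ℝ) 1,
      ∀ (x : Fin n → ℝ) (v : Fin m → ℝ),
        ‖∫ w : Fin m → ℝ,
            Complex.exp (Complex.I * ((∑ i, v i * w i : ℝ) : ℂ)) *
              a (x, Real.sqrt hbar • w) *
              Complex.exp (Complex.I *
                ((∑ i, ∑ j, q i j (x, Real.sqrt hbar • w) * w i * w j : ℝ) : ℂ)) *
              ψ w‖ * (1 + ‖v‖) ^ N ≤ C := by
  intro N
  let ι := Set.Ioc (0 : ℝ) 1 × (Fin n → ℝ)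
  let c : ι → (Fin n → ℝ) × (Fin m → ℝ) := fun t ↦ (t.2, 0)
  let L : ι → (Fin m → ℝ) →L[ℝ] (Fin n → ℝ) × (Fin m → ℝ) := fun t ↦
    Real.sqrt t.1 • ContinuousLinearMap.inr ℝ (Fin n → ℝ) (Fin m → ℝ)
  have hL : ∀ t, ‖L t‖ ≤ 1 := by
    intro t
    refine ContinuousLinearMap.opNorm_le_bound _ zero_le_one fun w ↦ ?_
    have h1 : Real.sqrt t.1 ≤ 1 := Real.sqrt_le_one.2 t.1.2.2
    simp only [L, smul_apply, norm_smul, ContinuousLinearMap.inr_apply,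
      Prod.norm_mk, norm_zero, Real.norm_of_nonneg (Real.sqrt_nonneg _),
      max_eq_right (norm_nonneg w)]
    gcongr
  have hcL : ∀ t w, c t + L t w = (t.2, Real.sqrt t.1 • w) := by
    intro t w
    simp [c, L]
  have hA : UniformTemperateGrowth (fun (t : ι) w ↦ a (t.2, Real.sqrt t.1 • w)) := by
    simpa only [hcL] using UniformTemperateGrowth.of_bounded_comp_affine ha haB c L hL
  have hcoord : ∀ i, UniformTemperateGrowth (fun (_ : ι) (w : Fin m → ℝ) ↦ w i) := fun i ↦
    .const (ContinuousLinearMap.proj (R := ℝ) (φ := fun _ : Fin m ↦ ℝ) i).hasTemperateGrowth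
  have hQ : UniformTemperateGrowth (fun (t : ι) w ↦
      ∑ i, ∑ j, q i j (t.2, Real.sqrt t.1 • w) * w i * w j) := by
    refine .sum fun i _ ↦ .sum fun j _ ↦ .mul (.mul ?_ (hcoord i)) (hcoord j)
    simpa only [hcL] using UniformTemperateGrowth.of_bounded_comp_affine (hq i j) (hqB i j) c L hL
  have hE := UniformTemperateGrowth.comp_of_bounded
    (g := fun s : ℝ ↦ Complex.exp (Complex.I * s))
    (Complex.contDiff_exp.comp (contDiff_const.mul Complex.ofRealCLM.contDiff))
    (fun j ↦ ⟨1, fun s ↦ (norm_iteratedFDeriv_cexp_I_mul_ofReal j s).le⟩) hQ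
  have hAE := hA.mul hE
  obtain ⟨C, hC, h⟩ := exists_oscillatory_integral_decay
    (fun t ↦ (hAE.1 t).mul (ψ.smooth ⊤)) (hAE.mul_schwartz ψ) N
  refine ⟨C, hC, fun hbar hh x v ↦ ?_⟩
  simpa only [mul_assoc] using h (⟨hbar, hh⟩, x) v
end
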